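/- For all σ ∈ (0,1], all a ∈ Sⁿ, and all t ≥ (2d+1)·n/σ, the probability under ν_{a,σ} that C(z) ≥ t is at most 13·d·n/(σ·t). -/

import Mathlib

open MeasureTheory
open scoped RealInnerProductSpace

/-- The spherical cap `{z ∈ Sⁿ : ⟨z,a⟩ > √(1-ρ²)}` in `Sⁿ ⊆ ℝ^{n+1}`. -/
noncomputable def cap (n : ℕ) (a : EuclideanSpace ℝ (Fin (n + 1))) (ρ : ℝ) :
    Set (EuclideanSpace ℝ (Fin (n + 1))) :=
  {z | z ∈ Metric.sphere (0 : EuclideanSpace ℝ (Fin (n + 1))) 1 ∧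
       Real.sqrt (1 - ρ ^ 2) < ⟪z, a⟫}

/-- `ν_{a,σ}`: the uniform probability measure on `cap(a,σ)`, i.e. the normalized
`n`-dimensional Hausdorff (surface) measure restricted to `cap(a,σ)`. -/
noncomputable def nuMeasure (n : ℕ) (a : EuclideanSpace ℝ (Fin (n + 1))) (σ : ℝ) :
    Measure (EuclideanSpace ℝ (Fin (n + 1))) :=
  (μH[(n : ℝ)] (cap n a σ))⁻¹ • (μH[(n : ℝ)]).restrict (cap n a σ)

section GaussianSmoothing

open ProbabilityTheory
open scoped ENNReal

section PlaneRotation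

variable {E : Type*} [NormedAddCommGroup E] [InnerProductSpace ℝ E] [FiniteDimensional ℝ E]
  [MeasurableSpace E] [BorelSpace E]

/-- The rotation of `E × E` mixing the two factors. -/
def planeRot (c s : ℝ) (p : E × E) : E × E := (c • p.1 + s • p.2, (-s) • p.1 + c • p.2)

lemma continuous_planeRot (c s : ℝ) : Continuous (planeRot (E := E) c s) := by
  unfold planeRot; fun_prop

lemma map_planeRot_of_charFun {μ : Measure E} [IsProbabilityMeasure μ]
    (hμ : ∀ t, charFun μ t = Complex.exp (-‖t‖ ^ 2 / 2)) {c s : ℝ} (hcs : c ^ 2 + s ^ 2 = 1) :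
    (μ.prod μ).map (planeRot c s) = μ.prod μ := by
  have hm : Measurable (planeRot (E := E) c s) := (continuous_planeRot c s).measurable
  have : IsProbabilityMeasure ((μ.prod μ).map (planeRot c s)) :=
    Measure.isProbabilityMeasure_map hm.aemeasurable
  refine charFun_eq_prod_iff.1 fun t => ?_
  have key : charFun (((μ.prod μ).map (planeRot c s)).map (WithLp.toLp 2)) t
      = charFun ((μ.prod μ).map (WithLp.toLp 2)) (WithLp.toLp 2 (planeRot c (-s) t.ofLp)) := by
    have h2 : Measurable (WithLp.toLp 2 : E × E → WithLp 2 (E × E)) := by fun_prop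
    rw [charFun_apply, charFun_apply, Measure.map_map h2 hm,
      integral_map (h2.comp hm).aemeasurable (by fun_prop), integral_map h2.aemeasurable (by fun_prop)]
    refine integral_congr_ae (Filter.Eventually.of_forall fun p => ?_)
    simp only [Function.comp_apply, WithLp.prod_inner_apply, planeRot, inner_add_left,
      inner_add_right, inner_smul_left, inner_smul_right]
    simp
    ring_nf
  rw [key, charFun_prod, hμ, hμ, hμ, hμ, ← Complex.exp_add, ← Complex.exp_add]
  congr 1
  have h1 : ∀ x y : E, ‖c • x + (-s) • y‖ ^ 2 + ‖(- -s) • x + c • y‖ ^ 2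
      = ‖x‖ ^ 2 + ‖y‖ ^ 2 := by
    intro x y
    rw [norm_add_sq_real, norm_add_sq_real]
    simp only [norm_smul, inner_smul_left, inner_smul_right, mul_pow, Real.norm_eq_abs, sq_abs]
    simp
    linear_combination (‖x‖ ^ 2 + ‖y‖ ^ 2) * hcs
  have h2 := congrArg (fun x : ℝ => (x : ℂ)) (h1 t.ofLp.1 t.ofLp.2)
  push_cast at h2
  simp only [planeRot]
  linear_combination (-1 / 2) * h2

lemma lintegral_planeRot_of_charFun {μ : Measure E} [IsProbabilityMeasure μ]
    (hμ : ∀ t, charFun μ t = Complex.exp (-‖t‖ ^ 2 / 2)) {c s : ℝ} (hcs : c ^ 2 + s ^ 2 = 1)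
    {f : E × E → ℝ≥0∞} (hf : Measurable f) :
    ∫⁻ p, f (planeRot c s p) ∂(μ.prod μ) = ∫⁻ p, f p ∂(μ.prod μ) := by
  conv_rhs => rw [← map_planeRot_of_charFun hμ hcs]
  rw [lintegral_map hf (continuous_planeRot c s).measurable]

lemma charFun_gaussianReal_std (t : ℝ) :
    charFun (gaussianReal 0 1) t = Complex.exp (-‖t‖ ^ 2 / 2) := by
  rw [charFun_gaussianReal]
  congr 1
  have : ((‖t‖ : ℝ) : ℂ) ^ 2 = (t : ℂ) ^ 2 := by
    rw [Real.norm_eq_abs, ← Complex.ofReal_pow, sq_abs, Complex.ofReal_pow]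
  rw [this]
  simp
  ring

/-- The standard Gaussian splits along a unit vector. -/
lemma map_gaussian_split {e : E} (he : ‖e‖ = 1) :
    ((gaussianReal 0 1).prod (stdGaussian E)).map (fun p => p.1 • e + (p.2 - ⟪p.2, e⟫ • e))
      = stdGaussian E := by
  have hm : Measurable (fun p : ℝ × E => p.1 • e + (p.2 - ⟪p.2, e⟫ • e)) := by fun_prop
  have : IsProbabilityMeasure (((gaussianReal 0 1).prod (stdGaussian E)).map
      (fun p => p.1 • e + (p.2 - ⟪p.2, e⟫ • e))) :=
    Measure.isProbabilityMeasure_map hm.aemeasurable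
  apply Measure.ext_of_charFun
  ext t
  have key : charFun (((gaussianReal 0 1).prod (stdGaussian E)).map
      (fun p => p.1 • e + (p.2 - ⟪p.2, e⟫ • e))) t
      = charFun (((gaussianReal 0 1).prod (stdGaussian E)).map (WithLp.toLp 2))
        (WithLp.toLp 2 (⟪e, t⟫, t - ⟪e, t⟫ • e)) := by
    have h2 : Measurable (WithLp.toLp 2 : ℝ × E → WithLp 2 (ℝ × E)) := by fun_prop
    rw [charFun_apply, charFun_apply,
      integral_map hm.aemeasurable (by fun_prop), integral_map h2.aemeasurable (by fun_prop)]
    refine integral_congr_ae (Filter.Eventually.of_forall fun p => ?_)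
    simp only [WithLp.prod_inner_apply, inner_add_left, inner_sub_left, inner_sub_right,
      inner_smul_left, inner_smul_right]
    simp
    ring_nf
  rw [key, charFun_prod, charFun_gaussianReal_std, charFun_stdGaussian, charFun_stdGaussian,
    ← Complex.exp_add]
  congr 1
  have h1 : ‖⟪e, t⟫‖ ^ 2 + ‖t - ⟪e, t⟫ • e‖ ^ 2 = ‖t‖ ^ 2 := by
    rw [norm_sub_sq_real, norm_smul, inner_smul_right, he, real_inner_comm]
    simp
    ring
  have h2 := congrArg (fun x : ℝ => (x : ℂ)) h1
  push_cast at h2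
  simp only []
  linear_combination (-1 / 2) * h2

lemma lintegral_gaussian_split {e : E} (he : ‖e‖ = 1) {f : E → ℝ≥0∞} (hf : Measurable f) :
    ∫⁻ x, f x ∂(stdGaussian E) =
      ∫⁻ v, ∫⁻ g, f (g • e + (v - ⟪v, e⟫ • e)) ∂(gaussianReal 0 1) ∂(stdGaussian E) := by
  conv_lhs => rw [← map_gaussian_split he]
  rw [lintegral_map hf (by fun_prop), lintegral_prod_symm' _ (by fun_prop)]

lemma lintegral_gaussian_inner {e : E} (he : ‖e‖ = 1) {f : ℝ → ℝ≥0∞} (hf : Measurable f) :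
    ∫⁻ x, f ⟪x, e⟫ ∂(stdGaussian E) = ∫⁻ g, f g ∂(gaussianReal 0 1) := by
  rw [lintegral_gaussian_split he (f := fun x => f ⟪x, e⟫) (by fun_prop)]
  simp [inner_add_left, inner_sub_left, inner_smul_left, he]

end PlaneRotation

section OneDim

lemma lintegral_sq_gaussianReal : ∫⁻ g, ENNReal.ofReal (g ^ 2) ∂(gaussianReal 0 1) = 1 := by
  have h := variance_id_gaussianReal (μ := 0) (v := 1)
  rw [variance_eq_integral measurable_id.aemeasurable] at h
  simp only [id_eq, integral_id_gaussianReal, sub_zero] at h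
  rw [← ofReal_integral_eq_lintegral_ofReal, h]
  · simp
  · have := (memLp_id_gaussianReal (μ := 0) (v := 1) 2).integrable_sq
    simpa using this
  · exact Filter.Eventually.of_forall fun x => sq_nonneg x

lemma lintegral_gaussianReal_eq {f : ℝ → ℝ≥0∞} (hf : Measurable f) :
    ∫⁻ g, f g ∂(gaussianReal 0 1)
      = ∫⁻ g, ENNReal.ofReal ((√(2 * Real.pi))⁻¹ * Real.exp (-g ^ 2 / 2)) * f g := by
  rw [gaussianReal_of_var_ne_zero _ one_ne_zero,
    lintegral_withDensity_eq_lintegral_mul _ (measurable_gaussianPDF 0 1) hf]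
  simp [gaussianPDF, gaussianPDFReal]

lemma lintegral_gaussianReal_radial {f : ℝ → ℝ≥0∞} (hf : Measurable f) :
    ∫⁻ g, ∫⁻ h, f (√(g ^ 2 + h ^ 2)) ∂(gaussianReal 0 1) ∂(gaussianReal 0 1)
      = ∫⁻ r in Set.Ioi 0, ENNReal.ofReal (r * Real.exp (-r ^ 2 / 2)) * f r := by
  have h1 : ∫⁻ g, ∫⁻ h, f (√(g ^ 2 + h ^ 2)) ∂(gaussianReal 0 1) ∂(gaussianReal 0 1)
      = ∫⁻ p : ℝ × ℝ, ENNReal.ofReal ((2 * Real.pi)⁻¹ * Real.exp (-(p.1 ^ 2 + p.2 ^ 2) / 2))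
          * f (√(p.1 ^ 2 + p.2 ^ 2)) := by
    rw [Measure.volume_eq_prod, lintegral_prod _ (by fun_prop), lintegral_gaussianReal_eq
      (Measurable.lintegral_prod_right' (f := fun p : ℝ × ℝ => f (√(p.1 ^ 2 + p.2 ^ 2)))
        (by fun_prop))]
    refine lintegral_congr fun g => ?_
    rw [lintegral_gaussianReal_eq (by fun_prop), ← lintegral_const_mul _ (by fun_prop)]
    refine lintegral_congr fun h => ?_
    rw [← mul_assoc, ← ENNReal.ofReal_mul (by positivity)]
    congr 2
    have : (2 * Real.pi)⁻¹ = (√(2 * Real.pi))⁻¹ * (√(2 * Real.pi))⁻¹ := by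
      rw [← mul_inv, Real.mul_self_sqrt (by positivity)]
    rw [this, neg_add, add_div, Real.exp_add]
    ring
  rw [h1, ← lintegral_comp_polarCoord_symm]
  have h2 : polarCoord.target = Set.Ioi (0 : ℝ) ×ˢ Set.Ioo (-Real.pi) Real.pi := rfl
  rw [h2, Measure.volume_eq_prod, setLIntegral_prod _ (by
    simp only [polarCoord_symm_apply]
    fun_prop)]
  refine setLIntegral_congr_fun measurableSet_Ioi fun r hr => ?_
  have hr0 : (0 : ℝ) < r := hr
  have h3 : ∀ θ : ℝ, ENNReal.ofReal r • (ENNReal.ofReal ((2 * Real.pi)⁻¹ * Real.exp (-((polarCoord.symm (r, θ)).1 ^ 2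
      + (polarCoord.symm (r, θ)).2 ^ 2) / 2))
          * f (√((polarCoord.symm (r, θ)).1 ^ 2 + (polarCoord.symm (r, θ)).2 ^ 2)))
      = ENNReal.ofReal (2 * Real.pi)⁻¹ * (ENNReal.ofReal (r * Real.exp (-r ^ 2 / 2)) * f r) := by
    intro θ
    have : (r * Real.cos θ) ^ 2 + (r * Real.sin θ) ^ 2 = r ^ 2 := by
      linear_combination r ^ 2 * Real.sin_sq_add_cos_sq θ
    simp only [polarCoord_symm_apply, this, Real.sqrt_sq hr0.le, smul_eq_mul]
    rw [← mul_assoc, ← mul_assoc, ← ENNReal.ofReal_mul (by positivity),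
      ← ENNReal.ofReal_mul (by positivity)]
    congr 2
    ring
  simp only [h3, lintegral_const, Measure.restrict_apply MeasurableSet.univ, Set.univ_inter,
    Real.volume_Ioo]
  rw [mul_comm, ← mul_assoc, ← ENNReal.ofReal_mul (by linarith [Real.pi_pos])]
  have : (Real.pi - -Real.pi) * (2 * Real.pi)⁻¹ = 1 := by
    field_simp; ring
  rw [this]; simp

lemma lintegral_inv_radius : ∫⁻ g, ∫⁻ h, ENNReal.ofReal (√(g ^ 2 + h ^ 2))⁻¹
    ∂(gaussianReal 0 1) ∂(gaussianReal 0 1) = ENNReal.ofReal √(Real.pi / 2) := by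
  rw [lintegral_gaussianReal_radial (f := fun r => ENNReal.ofReal r⁻¹) (by fun_prop)]
  have h1 : ∫⁻ r in Set.Ioi (0:ℝ), ENNReal.ofReal (r * Real.exp (-r ^ 2 / 2)) * ENNReal.ofReal r⁻¹
      = ∫⁻ r in Set.Ioi (0:ℝ), ENNReal.ofReal (Real.exp (-(1/2) * r ^ 2)) := by
    refine setLIntegral_congr_fun measurableSet_Ioi fun r hr => ?_
    have hr0 : (0 : ℝ) < r := hr
    rw [← ENNReal.ofReal_mul (by positivity)]
    congr 1
    field_simp
  rw [h1, ← ofReal_integral_eq_lintegral_ofReal, integral_gaussian_Ioi]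
  · congr 1
    have : Real.pi / (1/2) = 2 ^ 2 * (Real.pi / 2) := by ring
    rw [this, Real.sqrt_mul (by positivity), Real.sqrt_sq (by norm_num)]
    ring
  · exact (integrable_exp_neg_mul_sq (by norm_num)).integrableOn
  · exact Filter.Eventually.of_forall fun x => (Real.exp_pos _).le

lemma lintegral_Ioi_mul_exp {a : ℝ} (ha : 0 ≤ a) :
    ∫⁻ r in Set.Ioi (√a), ENNReal.ofReal (r * Real.exp (-r ^ 2 / 2))
      = ENNReal.ofReal (Real.exp (-a / 2)) := by
  have hd : ∀ x ∈ Set.Ici (√a), HasDerivAt (fun r => -Real.exp (-r ^ 2 / 2))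
      (x * Real.exp (-x ^ 2 / 2)) x := by
    intro x _
    have h : HasDerivAt (fun r : ℝ => -r ^ 2 / 2) (-x) x := by
      have := ((hasDerivAt_pow 2 x).neg).div_const 2
      refine this.congr_deriv ?_
      push_cast; ring
    exact h.exp.neg.congr_deriv (by ring)
  have hpos : ∀ x ∈ Set.Ioi (√a), 0 ≤ x * Real.exp (-x ^ 2 / 2) := fun x hx =>
    mul_nonneg ((Real.sqrt_nonneg a).trans (le_of_lt hx)) (Real.exp_pos _).le
  have hlim : Filter.Tendsto (fun r : ℝ => -Real.exp (-r ^ 2 / 2)) Filter.atTop (nhds 0) := by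
    rw [← neg_zero]
    refine (Real.tendsto_exp_atBot.comp ?_).neg
    have : Filter.Tendsto (fun r : ℝ => r ^ 2 / 2) Filter.atTop Filter.atTop :=
      (Filter.tendsto_pow_atTop two_ne_zero).atTop_div_const (by norm_num)
    refine (Filter.tendsto_neg_atTop_atBot.comp this).congr fun x => ?_
    simp; ring
  have hintegr := integrableOn_Ioi_deriv_of_nonneg' hd hpos hlim
  rw [← ofReal_integral_eq_lintegral_ofReal hintegr
    ((ae_restrict_iff' measurableSet_Ioi).2 (Filter.Eventually.of_forall hpos)),
    integral_Ioi_of_hasDerivAt_of_nonneg' hd hpos hlim]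
  simp [Real.sq_sqrt ha]

lemma gaussianReal_radius_tail (a : ℝ) (ha : 0 ≤ a) :
    ∫⁻ g, ∫⁻ h, Set.indicator {r : ℝ | a < r ^ 2} 1 (√(g ^ 2 + h ^ 2))
    ∂(gaussianReal 0 1) ∂(gaussianReal 0 1) = ENNReal.ofReal (Real.exp (-a / 2)) := by
  have hms : MeasurableSet {r : ℝ | a < r ^ 2} := measurableSet_lt (by fun_prop) (by fun_prop)
  rw [lintegral_gaussianReal_radial (measurable_one.indicator hms)]
  have h1 : ∫⁻ r in Set.Ioi (0:ℝ), ENNReal.ofReal (r * Real.exp (-r ^ 2 / 2))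
        * Set.indicator {r : ℝ | a < r ^ 2} 1 r
      = ∫⁻ r in Set.Ioi (√a), ENNReal.ofReal (r * Real.exp (-r ^ 2 / 2)) := by
    rw [← lintegral_indicator measurableSet_Ioi, ← lintegral_indicator measurableSet_Ioi]
    refine lintegral_congr fun r => ?_
    by_cases hr : √a < r
    · have h0 : 0 < r := (Real.sqrt_nonneg a).trans_lt hr
      have : a < r ^ 2 := (Real.sqrt_lt' h0).1 hr
      simp [Set.indicator, hr, h0, this]
    · by_cases h0 : 0 < r
      · have : ¬ a < r ^ 2 := fun h => hr ((Real.sqrt_lt' h0).2 h)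
        simp [Set.indicator, hr, this]
      · simp [Set.indicator, hr, h0]
  rw [h1]
  exact lintegral_Ioi_mul_exp ha

lemma lintegral_exp_sq_gaussianReal {k : ℝ} (hk : 0 ≤ k) :
    ∫⁻ g, ENNReal.ofReal (Real.exp (-k * g ^ 2 / 2)) ∂(gaussianReal 0 1)
      = ENNReal.ofReal (√(1 + k))⁻¹ := by
  rw [lintegral_gaussianReal_eq (by fun_prop)]
  have : ∀ g : ℝ, ENNReal.ofReal ((√(2 * Real.pi))⁻¹ * Real.exp (-g ^ 2 / 2))
        * ENNReal.ofReal (Real.exp (-k * g ^ 2 / 2))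
      = ENNReal.ofReal ((√(2 * Real.pi))⁻¹ * Real.exp (-((1 + k)/2) * g ^ 2)) := by
    intro g
    rw [← ENNReal.ofReal_mul (by positivity), mul_assoc, ← Real.exp_add]
    congr 3; ring
  simp_rw [this]
  rw [← ofReal_integral_eq_lintegral_ofReal, integral_const_mul, integral_gaussian]
  · congr 1
    rw [show Real.pi / ((1 + k)/2) = (2 * Real.pi) / (1 + k) by field_simp,
      Real.sqrt_div (by positivity)]
    have : √(2 * Real.pi) ≠ 0 := by positivity
    field_simp
  · exact (integrable_exp_neg_mul_sq (by positivity)).const_mul _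
  · exact Filter.Eventually.of_forall fun x => by positivity

end OneDim

section NullSet

lemma measurable_eval_mvPolynomial {m : ℕ} (P : MvPolynomial (Fin m) ℝ) :
    Measurable fun x : Fin m → ℝ => MvPolynomial.eval x P :=
  (MvPolynomial.continuous_eval P).measurable

lemma pi_eval_eq_zero (ν : Measure ℝ) [SigmaFinite ν] [NullSingletonClass ν] :
    ∀ (m : ℕ) (P : MvPolynomial (Fin m) ℝ), P ≠ 0 →
      Measure.pi (fun _ : Fin m => ν) {x | MvPolynomial.eval x P = 0} = 0 := by
  intro m
  induction m with
  | zero =>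
    intro P hP
    have : {x : Fin 0 → ℝ | MvPolynomial.eval x P = 0} = ∅ := by
      ext x
      simp only [Set.mem_ofPred_eq, Set.mem_empty_iff_false, iff_false]
      intro h
      apply hP
      apply MvPolynomial.funext
      intro y
      rw [Subsingleton.elim y x, h, map_zero]
    rw [this, measure_empty]
  | succ m ih =>
    intro P hP
    set Q := MvPolynomial.finSuccEquiv ℝ m P with hQ
    have hQ0 : Q ≠ 0 := by
      rw [hQ]; simpa using hP
    have hmp := measurePreserving_piFinSuccAbove (fun _ : Fin (m + 1) => ν) 0
    have hmeas : MeasurableSet {x : Fin (m + 1) → ℝ | MvPolynomial.eval x P = 0} :=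
      measurable_eval_mvPolynomial P (measurableSet_singleton 0)
    rw [← hmp.symm.measure_preimage hmeas.nullMeasurableSet,
      Measure.prod_apply_symm (hmp.symm.measurable hmeas), lintegral_eq_zero_iff
      (measurable_measure_prodMk_right (hmp.symm.measurable hmeas))]
    have h := ih Q.leadingCoeff (Polynomial.leadingCoeff_ne_zero.2 hQ0)
    have h' : ∀ᵐ y ∂(Measure.pi fun _ : Fin m => ν), MvPolynomial.eval y Q.leadingCoeff ≠ 0 := by
      rw [ae_iff]; simpa using h
    filter_upwards [h'] with y hy
    have hq : Polynomial.map (MvPolynomial.eval y) Q ≠ 0 := by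
      intro h0
      apply hy
      have := congrArg (fun p => p.coeff Q.natDegree) h0
      simpa [Polynomial.coeff_map] using this
    refine measure_mono_null (t := {x | (Polynomial.map (MvPolynomial.eval y) Q).IsRoot x}) ?_
      (Set.Finite.measure_zero (Polynomial.finite_setOfPred_isRoot hq) _)
    intro x hx
    simp only [Set.mem_preimage, Set.mem_ofPred_eq] at hx
    have hc : (MeasurableEquiv.piFinSuccAbove (fun _ : Fin (m + 1) => ℝ) 0).symm (x, y)
        = Fin.cons x y := by
      simp [MeasurableEquiv.piFinSuccAbove, Fin.insertNthEquiv]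
    rw [hc, MvPolynomial.eval_eq_eval_mv_eval'] at hx
    exact hx

lemma stdGaussian_eval_eq_zero {m : ℕ} {P : MvPolynomial (Fin m) ℝ} (hP : P ≠ 0) :
    stdGaussian (EuclideanSpace ℝ (Fin m)) {x | MvPolynomial.eval (fun i => x i) P = 0} = 0 := by
  have : NullSingletonClass (gaussianReal 0 1) := nullSingletonClass_gaussianReal one_ne_zero
  have hc : Measurable (fun x : EuclideanSpace ℝ (Fin m) => MvPolynomial.eval (fun i => x i) P) :=
    (measurable_eval_mvPolynomial P).comp (by fun_prop)
  rw [← map_pi_eq_stdGaussian, Measure.map_apply (by fun_prop)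
    (show MeasurableSet {x : EuclideanSpace ℝ (Fin m) | MvPolynomial.eval (fun i => x i) P = 0} from
      hc (measurableSet_singleton 0))]
  exact pi_eval_eq_zero _ m P hP

end NullSet

section ExpNorm

lemma lintegral_exp_norm_sq_stdGaussian {m : ℕ} {k : ℝ} (hk : 0 ≤ k) :
    ∫⁻ x, ENNReal.ofReal (Real.exp (-k * ‖x‖ ^ 2 / 2)) ∂(stdGaussian (EuclideanSpace ℝ (Fin m)))
      = ENNReal.ofReal (√(1 + k))⁻¹ ^ m := by
  rw [← map_pi_eq_stdGaussian, lintegral_map (by fun_prop) (by fun_prop)]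
  have hintegr : Integrable (fun g => Real.exp (-k * g ^ 2 / 2)) (gaussianReal 0 1) := by
    refine ⟨by fun_prop, ?_⟩
    rw [hasFiniteIntegral_iff_ofReal (Filter.Eventually.of_forall fun x => (Real.exp_pos _).le),
      lintegral_exp_sq_gaussianReal hk]
    exact ENNReal.ofReal_lt_top
  have h1 : ∀ x : Fin m → ℝ, Real.exp (-k * ‖WithLp.toLp 2 x‖ ^ 2 / 2)
      = ∏ i, Real.exp (-k * x i ^ 2 / 2) := by
    intro x
    rw [← Real.exp_sum, EuclideanSpace.real_norm_sq_eq, Finset.mul_sum, Finset.sum_div]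
  simp_rw [h1]
  rw [← ofReal_integral_eq_lintegral_ofReal (Integrable.fintype_prod (fun _ => hintegr))
    (Filter.Eventually.of_forall fun x => Finset.prod_nonneg fun i _ => (Real.exp_pos _).le),
    integral_fintype_prod_eq_prod (fun (_ : Fin m) (g : ℝ) => Real.exp (-k * g ^ 2 / 2))]
  rw [← ENNReal.ofReal_pow (by positivity)]
  congr 1
  rw [Finset.prod_const, Finset.card_univ, Fintype.card_fin]
  congr 1
  rw [integral_eq_lintegral_of_nonneg_ae (Filter.Eventually.of_forall fun x => (Real.exp_pos _).le)
    (by fun_prop), lintegral_exp_sq_gaussianReal hk, ENNReal.toReal_ofReal (by positivity)]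

lemma lintegral_exp_perp {E : Type*} [NormedAddCommGroup E] [InnerProductSpace ℝ E]
    [FiniteDimensional ℝ E] [MeasurableSpace E] [BorelSpace E] {k : ℝ} (hk : 0 ≤ k)
    {e : E} (he : ‖e‖ = 1) {f : E → ℝ≥0∞} (hf : Measurable f)
    (hfe : ∀ x (r : ℝ), f (r • e + x) = ENNReal.ofReal (Real.exp (-k * (r ^ 2 + 2 * r * ⟪x, e⟫) / 2)) * f x) :
    ∫⁻ x, f x ∂(stdGaussian E) = ENNReal.ofReal (√(1 + k))⁻¹ *
      ∫⁻ x, f (x - ⟪x, e⟫ • e) ∂(stdGaussian E) := by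
  have hm : Measurable fun x : E => f (x - ⟪x, e⟫ • e) := by fun_prop
  rw [lintegral_gaussian_split he hf, ← lintegral_const_mul _ hm]
  refine lintegral_congr fun v => ?_
  simp_rw [hfe]
  rw [lintegral_mul_const _ (by fun_prop), ← lintegral_exp_sq_gaussianReal hk]
  simp [inner_sub_left, inner_smul_left, he]

lemma lintegral_exp_perp_one {n : ℕ} {k : ℝ} (hk : 0 ≤ k)
    {a : EuclideanSpace ℝ (Fin (n + 1))} (ha : ‖a‖ = 1) :
    ∫⁻ x, ENNReal.ofReal (Real.exp (-k * (‖x‖ ^ 2 - ⟪x, a⟫ ^ 2) / 2))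
        ∂(stdGaussian (EuclideanSpace ℝ (Fin (n + 1))))
      = ENNReal.ofReal (√(1 + k))⁻¹ ^ n := by
  have hc : ENNReal.ofReal (√(1 + k))⁻¹ ≠ 0 := by
    rw [Ne, ENNReal.ofReal_eq_zero, not_le]; positivity
  have h := lintegral_exp_norm_sq_stdGaussian (m := n + 1) hk
  rw [lintegral_exp_perp hk ha (by fun_prop), pow_succ', ENNReal.mul_right_inj hc
    ENNReal.ofReal_ne_top] at h
  · rw [← h]
    refine lintegral_congr fun x => ?_
    congr 3
    rw [norm_sub_sq_real, norm_smul, inner_smul_right, ha]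
    simp
    left
    ring
  · intro x r
    rw [← ENNReal.ofReal_mul (by positivity), ← Real.exp_add, norm_add_sq_real, norm_smul,
      inner_smul_left, ha, real_inner_comm]
    congr 2
    simp
    ring

lemma lintegral_exp_perp_two {n : ℕ} {k : ℝ} (hk : 0 ≤ k)
    {a b : EuclideanSpace ℝ (Fin (n + 1))} (ha : ‖a‖ = 1) (hb : ‖b‖ = 1) (hab : ⟪b, a⟫ = 0)
    (hn : 1 ≤ n) :
    ∫⁻ x, ENNReal.ofReal (Real.exp (-k * (‖x‖ ^ 2 - ⟪x, a⟫ ^ 2 - ⟪x, b⟫ ^ 2) / 2))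
        ∂(stdGaussian (EuclideanSpace ℝ (Fin (n + 1))))
      = ENNReal.ofReal (√(1 + k))⁻¹ ^ (n - 1) := by
  have hc : ENNReal.ofReal (√(1 + k))⁻¹ ≠ 0 := by
    rw [Ne, ENNReal.ofReal_eq_zero, not_le]; positivity
  have h := lintegral_exp_perp_one hk ha
  obtain ⟨l, rfl⟩ := Nat.exists_eq_add_of_le' hn
  rw [lintegral_exp_perp hk hb (by fun_prop), pow_succ', ENNReal.mul_right_inj hc
    ENNReal.ofReal_ne_top] at h
  · rw [Nat.add_sub_cancel, ← h]
    refine lintegral_congr fun x => ?_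
    congr 3
    rw [norm_sub_sq_real, norm_smul, inner_smul_right, inner_sub_left, inner_smul_left, hb, hab]
    simp
    left
    ring
  · intro x r
    rw [← ENNReal.ofReal_mul (by positivity), ← Real.exp_add, norm_add_sq_real, norm_smul,
      inner_smul_left, inner_add_left, inner_smul_left, hb, hab, real_inner_comm]
    congr 2
    simp
    ring

end ExpNorm

section SphereUniqueness

variable {E : Type*} [NormedAddCommGroup E] [InnerProductSpace ℝ E] [FiniteDimensional ℝ E]
  [MeasurableSpace E] [BorelSpace E]

lemma charFun_eq_of_norm_eq {μ : Measure E} (hμ : ∀ L : E ≃ₗᵢ[ℝ] E, μ.map L = μ) {s t : E}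
    (hst : ‖s‖ = ‖t‖) : charFun μ s = charFun μ t := by
  set L := (ℝ ∙ (s - t))ᗮ.reflection with hL
  have hLs : L s = t := Submodule.reflection_sub hst
  conv_rhs => rw [← hμ L, charFun_apply,
    integral_map (by fun_prop) (by fun_prop)]
  rw [charFun_apply, ← hLs]
  simp

/-- Two finite rotation-invariant measures on the unit sphere are proportional. -/
lemma smul_eq_smul_of_rotation_invariant {μ ν : Measure E} [IsFiniteMeasure μ] [IsFiniteMeasure ν]
    (hμ : ∀ L : E ≃ₗᵢ[ℝ] E, μ.map L = μ) (hν : ∀ L : E ≃ₗᵢ[ℝ] E, ν.map L = ν)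
    (hμs : ∀ᵐ x ∂μ, ‖x‖ = 1) (hνs : ∀ᵐ x ∂ν, ‖x‖ = 1) :
    μ Set.univ • ν = ν Set.univ • μ := by
  have h1 : IsFiniteMeasure (μ Set.univ • ν) := Measure.smul_finite ν (measure_ne_top μ _)
  have h2 : IsFiniteMeasure (ν Set.univ • μ) := Measure.smul_finite μ (measure_ne_top ν _)
  apply Measure.ext_of_charFun
  ext t
  have key : ∫ y, charFun μ (‖t‖ • y) ∂ν = ∫ x, charFun ν (‖t‖ • x) ∂μ := by
    simp_rw [charFun_apply]
    rw [integral_integral_swap]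
    · refine integral_congr_ae (Filter.Eventually.of_forall fun x => integral_congr_ae
        (Filter.Eventually.of_forall fun y => ?_))
      simp only [inner_smul_right, real_inner_comm x y]
    · refine (integrable_const (1 : ℝ)).mono' (by fun_prop) ?_
      refine Filter.Eventually.of_forall fun p => ?_
      simp [Function.uncurry, Complex.norm_exp]
  have hl : ∫ y, charFun μ (‖t‖ • y) ∂ν = ∫ _y, charFun μ t ∂ν := by
    refine integral_congr_ae ?_
    filter_upwards [hνs] with y hy
    exact charFun_eq_of_norm_eq hμ (by rw [norm_smul, hy, norm_norm, mul_one])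
  have hr : ∫ x, charFun ν (‖t‖ • x) ∂μ = ∫ _x, charFun ν t ∂μ := by
    refine integral_congr_ae ?_
    filter_upwards [hμs] with y hy
    exact charFun_eq_of_norm_eq hν (by rw [norm_smul, hy, norm_norm, mul_one])
  rw [hl, hr, integral_const, integral_const] at key
  simp only [charFun_apply] at key ⊢
  rw [integral_smul_measure, integral_smul_measure]
  exact key.symm

/-- Radial projection onto the unit sphere. -/
noncomputable def radialProj (z : E) : E := ‖z‖⁻¹ • z

lemma measurable_radialProj : Measurable (radialProj (E := E)) := by
  unfold radialProj; fun_prop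

lemma map_radialProj_invariant {μ : Measure E} (hμ : ∀ L : E ≃ₗᵢ[ℝ] E, μ.map L = μ)
    (L : E ≃ₗᵢ[ℝ] E) : (μ.map radialProj).map L = μ.map radialProj := by
  conv_rhs => rw [← hμ L]
  rw [Measure.map_map (by fun_prop) measurable_radialProj,
    Measure.map_map measurable_radialProj (by fun_prop)]
  congr 1
  ext z
  simp [radialProj]

lemma ae_norm_map_radialProj {μ : Measure E} (h0 : μ {0} = 0) :
    ∀ᵐ x ∂(μ.map radialProj), ‖x‖ = 1 := by
  rw [ae_map_iff measurable_radialProj.aemeasurable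
    (measurableSet_eq_fun (by fun_prop) (by fun_prop))]
  have : ∀ᵐ x ∂μ, x ≠ 0 := by
    rw [ae_iff]; simpa using h0
  filter_upwards [this] with x hx
  rw [radialProj, norm_smul, norm_inv, norm_norm, inv_mul_cancel₀ (norm_ne_zero_iff.2 hx)]

/-- Under a rotation-invariant law, norm and direction are uncorrelated. -/
lemma lintegral_norm_cone {μ : Measure E} [IsProbabilityMeasure μ]
    (hμ : ∀ L : E ≃ₗᵢ[ℝ] E, μ.map L = μ) (h0 : μ {0} = 0)
    (hfin : ∫⁻ z, ENNReal.ofReal ‖z‖ ∂μ ≠ ⊤) {A : Set E} (hA : MeasurableSet A)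
    (hcone : ∀ z, z ≠ 0 → (radialProj z ∈ A ↔ z ∈ A)) :
    ∫⁻ z in A, ENNReal.ofReal ‖z‖ ∂μ = (∫⁻ z, ENNReal.ofReal ‖z‖ ∂μ) * μ A := by
  set ρ := μ.withDensity fun z => ENNReal.ofReal ‖z‖ with hρ
  have hρu : ρ Set.univ = ∫⁻ z, ENNReal.ofReal ‖z‖ ∂μ := by
    rw [hρ, withDensity_apply _ MeasurableSet.univ, Measure.restrict_univ]
  have hρfin : IsFiniteMeasure ρ := ⟨by rw [hρu]; exact hfin.lt_top⟩
  have hρinv : ∀ L : E ≃ₗᵢ[ℝ] E, ρ.map L = ρ := by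
    intro L
    ext s hs
    rw [Measure.map_apply (by fun_prop) hs, hρ, withDensity_apply _ hs, withDensity_apply _
      ((by fun_prop : Measurable L) hs)]
    conv_rhs => rw [← hμ L]
    rw [setLIntegral_map hs (by fun_prop) (by fun_prop)]
    simp
  have hρ0 : ρ {0} = 0 := withDensity_absolutelyContinuous _ _ h0
  have : IsFiniteMeasure (μ.map (radialProj (E := E))) := Measure.isFiniteMeasure_map _ _
  have : IsFiniteMeasure (ρ.map (radialProj (E := E))) := Measure.isFiniteMeasure_map _ _
  have key := smul_eq_smul_of_rotation_invariant (map_radialProj_invariant hμ)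
    (map_radialProj_invariant hρinv) (ae_norm_map_radialProj h0) (ae_norm_map_radialProj hρ0)
  have key' := congrArg (fun m : Measure E => m A) key
  simp only [Measure.smul_apply, smul_eq_mul,
    Measure.map_apply measurable_radialProj hA, Measure.map_apply measurable_radialProj
    MeasurableSet.univ, Set.preimage_univ, measure_univ, one_mul, hρu] at key'
  have hae : ∀ {m : Measure E}, m {0} = 0 → m (radialProj ⁻¹' A) = m A := by
    intro m hm
    apply measure_congr
    have : ∀ᵐ x ∂m, x ≠ 0 := by
      rw [ae_iff]; simpa using hm
    filter_upwards [this] with x hx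
    exact propext (hcone x hx)
  rw [hae h0, hae hρ0, hρ, withDensity_apply _ hA] at key'
  exact key'

end SphereUniqueness

section GaussianFacts

variable {n : ℕ}

lemma stdGaussian_singleton_zero :
    stdGaussian (EuclideanSpace ℝ (Fin (n + 1))) {0} = 0 := by
  refine measure_mono_null ?_ (stdGaussian_eval_eq_zero (m := n + 1)
    (P := MvPolynomial.X 0) (MvPolynomial.X_ne_zero 0))
  intro x hx
  rw [Set.mem_singleton_iff] at hx
  simp [hx]

lemma lintegral_norm_sq_stdGaussian :
    ∫⁻ z, ENNReal.ofReal (‖z‖ ^ 2) ∂(stdGaussian (EuclideanSpace ℝ (Fin (n + 1)))) = n + 1 := by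
  have h : ∀ z : EuclideanSpace ℝ (Fin (n + 1)), ENNReal.ofReal (‖z‖ ^ 2)
      = ∑ i, ENNReal.ofReal (⟪z, EuclideanSpace.single i (1 : ℝ)⟫ ^ 2) := by
    intro z
    rw [EuclideanSpace.real_norm_sq_eq, ENNReal.ofReal_sum_of_nonneg fun i _ => sq_nonneg _]
    simp [EuclideanSpace.inner_single_right]
  simp_rw [h]
  rw [lintegral_finsetSum _ (fun i _ => by fun_prop)]
  simp_rw [fun i : Fin (n + 1) => lintegral_gaussian_inner
    (e := EuclideanSpace.single i (1 : ℝ)) (by simp) (f := fun r => ENNReal.ofReal (r ^ 2))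
    (by fun_prop), lintegral_sq_gaussianReal]
  simp

lemma lintegral_norm_stdGaussian_le :
    ∫⁻ z, ENNReal.ofReal ‖z‖ ∂(stdGaussian (EuclideanSpace ℝ (Fin (n + 1))))
      ≤ ENNReal.ofReal √(n + 1) := by
  set N : ℝ := n + 1 with hN
  have hNpos : 0 < N := by positivity
  have hs : 0 < √N := Real.sqrt_pos.2 hNpos
  calc ∫⁻ z, ENNReal.ofReal ‖z‖ ∂(stdGaussian (EuclideanSpace ℝ (Fin (n + 1))))
      ≤ ∫⁻ z, (ENNReal.ofReal (2 * √N)⁻¹ * ENNReal.ofReal (‖z‖ ^ 2) + ENNReal.ofReal (√N / 2))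
          ∂(stdGaussian (EuclideanSpace ℝ (Fin (n + 1)))) := by
        refine lintegral_mono fun z => ?_
        rw [← ENNReal.ofReal_mul (by positivity), ← ENNReal.ofReal_add (by positivity)
          (by positivity)]
        refine ENNReal.ofReal_le_ofReal ?_
        have h2 : (2 * √N)⁻¹ * ‖z‖ ^ 2 + √N / 2 - ‖z‖ = (‖z‖ - √N) ^ 2 / (2 * √N) := by
          field_simp
          ring_nf
        have h3 : 0 ≤ (‖z‖ - √N) ^ 2 / (2 * √N) := by positivity
        linarith
    _ = ENNReal.ofReal √N := by
        rw [lintegral_add_right _ (by fun_prop), lintegral_const_mul _ (by fun_prop),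
          lintegral_norm_sq_stdGaussian]
        simp only [lintegral_const, measure_univ, mul_one]
        rw [show ((n : ℝ≥0∞) + 1) = ENNReal.ofReal N by
          rw [hN, ENNReal.ofReal_add (by positivity) zero_le_one]; simp,
          ← ENNReal.ofReal_mul (by positivity), ← ENNReal.ofReal_add (by positivity)
          (by positivity)]
        congr 1
        have : N = √N * √N := (Real.mul_self_sqrt hNpos.le).symm
        field_simp
        nlinarith

end GaussianFacts

section Hausdorff

variable {n : ℕ}

local notation "𝔼" => EuclideanSpace ℝ (Fin (n + 1))

lemma isOpen_inner_lt (a : 𝔼) (r : ℝ) : IsOpen {z : 𝔼 | r < ⟪z, a⟫} :=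
  isOpen_lt continuous_const (by fun_prop)

lemma measurableSet_cap (a : 𝔼) (σ : ℝ) : MeasurableSet (cap n a σ) :=
  (Metric.isClosed_sphere.measurableSet).inter (isOpen_inner_lt a _).measurableSet

lemma hausdorff_cap_eq {a b : 𝔼} (hab : ‖a‖ = ‖b‖) (σ : ℝ) :
    μH[(n : ℝ)] (cap n a σ) = μH[(n : ℝ)] (cap n b σ) := by
  set L := (ℝ ∙ (a - b))ᗮ.reflection with hL
  have hLs : L a = b := Submodule.reflection_sub hab
  have h : L.toIsometryEquiv ⁻¹' (cap n b σ) = cap n a σ := by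
    ext z
    simp only [Set.mem_preimage, cap, Set.mem_ofPred_eq, mem_sphere_zero_iff_norm, ← hLs]
    simp
  rw [← h, IsometryEquiv.hausdorffMeasure_preimage]

lemma hausdorff_sphere_lt_top {a : 𝔼} (ha : ‖a‖ = 1) {σ : ℝ} (hσ : 0 < σ)
    (hcap : μH[(n : ℝ)] (cap n a σ) ≠ ⊤) : μH[(n : ℝ)] (Metric.sphere (0 : 𝔼) 1) < ⊤ := by
  obtain ⟨t, hts, htf, hcov⟩ := (isCompact_sphere (0 : 𝔼) 1).elim_finite_subcover_image
    (b := Metric.sphere (0 : 𝔼) 1) (c := fun b => {z : 𝔼 | √(1 - σ ^ 2) < ⟪z, b⟫})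
    (fun b _ => isOpen_inner_lt b _) (by
      intro z hz
      refine Set.mem_biUnion hz ?_
      have hz1 : ‖z‖ = 1 := by simpa using hz
      have : √(1 - σ ^ 2) < 1 := by
        rw [Real.sqrt_lt' one_pos]; nlinarith
      simpa [hz1] using this)
  have hsub : Metric.sphere (0 : 𝔼) 1 ⊆ ⋃ b ∈ t, cap n b σ := by
    intro z hz
    obtain ⟨b, hb, hzb⟩ := Set.mem_iUnion₂.1 (hcov hz)
    exact Set.mem_biUnion hb ⟨hz, hzb⟩
  refine (measure_mono hsub).trans_lt ((measure_biUnion_lt_top htf fun b hb => ?_))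
  rw [hausdorff_cap_eq (a := b) (b := a) (by rw [ha]; simpa using hts hb)]
  exact hcap.lt_top

/-- The normalized cap measure is a Gaussian ratio of cones. -/
lemma nuMeasure_eq_zero_or {a : 𝔼} (ha : ‖a‖ = 1) {σ : ℝ} (hσ : 0 < σ) {A : Set 𝔼}
    (hA : MeasurableSet A) : nuMeasure n a σ A = 0 ∨
      nuMeasure n a σ A * stdGaussian 𝔼 (radialProj ⁻¹' cap n a σ)
        = stdGaussian 𝔼 (radialProj ⁻¹' (A ∩ cap n a σ)) := by
  by_cases h0 : μH[(n : ℝ)] (cap n a σ) = 0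
  · left
    rw [nuMeasure, Measure.smul_apply, Measure.restrict_eq_zero.2 h0]
    simp
  by_cases ht : μH[(n : ℝ)] (cap n a σ) = ⊤
  · left
    simp [nuMeasure, ht]
  right
  set S : Set 𝔼 := Metric.sphere 0 1 with hS
  have hSm : MeasurableSet S := Metric.isClosed_sphere.measurableSet
  have hSfin := hausdorff_sphere_lt_top ha hσ ht
  set ρ : Measure 𝔼 := (μH[(n : ℝ)]).restrict S with hρ
  have : IsFiniteMeasure ρ := ⟨by rw [hρ, Measure.restrict_apply_univ]; exact hSfin⟩
  have hρinv : ∀ L : 𝔼 ≃ₗᵢ[ℝ] 𝔼, ρ.map L = ρ := by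
    intro L
    ext s hs
    have hLm : Measurable L := L.continuous.measurable
    rw [Measure.map_apply hLm hs, hρ, Measure.restrict_apply hs, Measure.restrict_apply (hLm hs),
      ← L.toIsometryEquiv.hausdorffMeasure_preimage _ (s ∩ S)]
    congr 1
    ext z
    simp [hS]
  have hρs : ∀ᵐ x ∂ρ, ‖x‖ = 1 := by
    filter_upwards [ae_restrict_mem hSm] with x hx
    simpa [hS] using hx
  have : IsFiniteMeasure ((stdGaussian 𝔼).map (radialProj (E := 𝔼))) :=
    Measure.isFiniteMeasure_map _ _
  have key := smul_eq_smul_of_rotation_invariant hρinv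
    (map_radialProj_invariant (fun L => stdGaussian_map (E := 𝔼) L)) hρs
    (ae_norm_map_radialProj stdGaussian_singleton_zero)
  have key' : ∀ B : Set 𝔼, MeasurableSet B → B ⊆ S →
      μH[(n : ℝ)] S * stdGaussian 𝔼 (radialProj ⁻¹' B) = μH[(n : ℝ)] B := by
    intro B hB hBS
    have := congrArg (fun m : Measure 𝔼 => m B) key
    simp only [Measure.smul_apply, smul_eq_mul, Measure.map_apply measurable_radialProj hB,
      Measure.map_apply measurable_radialProj MeasurableSet.univ, Set.preimage_univ, measure_univ,
      one_mul, hρ, Measure.restrict_apply hB, Measure.restrict_apply_univ,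
      Set.inter_eq_left.2 hBS] at this
    exact this
  have hcapS : cap n a σ ⊆ S := fun z hz => hz.1
  have hm := measurableSet_cap a σ
  have k1 := key' _ hm hcapS
  have k2 := key' _ (hA.inter hm) (Set.inter_subset_right.trans hcapS)
  have hS0 : μH[(n : ℝ)] S ≠ 0 := fun h => h0 (measure_mono_null hcapS h)
  rw [nuMeasure, Measure.smul_apply, smul_eq_mul, Measure.restrict_apply hA, ← k2]
  have hg0 : stdGaussian 𝔼 (radialProj ⁻¹' cap n a σ) ≠ 0 := by
    intro h; apply h0; rw [← k1, h, mul_zero]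
  have hgt : stdGaussian 𝔼 (radialProj ⁻¹' cap n a σ) ≠ ⊤ := measure_ne_top _ _
  rw [← k1, ENNReal.mul_inv (Or.inl hS0) (Or.inl hSfin.ne)]
  calc _ = ((μH[(n : ℝ)] S)⁻¹ * μH[(n : ℝ)] S) * ((stdGaussian 𝔼 (radialProj ⁻¹' cap n a σ))⁻¹
        * stdGaussian 𝔼 (radialProj ⁻¹' cap n a σ))
        * stdGaussian 𝔼 (radialProj ⁻¹' (A ∩ cap n a σ)) := by ring
    _ = _ := by
        rw [ENNReal.inv_mul_cancel hS0 hSfin.ne, ENNReal.inv_mul_cancel hg0 hgt, one_mul, one_mul]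

end Hausdorff

section DoubleCone

variable {E : Type*} [NormedAddCommGroup E] [InnerProductSpace ℝ E] [FiniteDimensional ℝ E]
  [MeasurableSpace E] [BorelSpace E]

/-- The open double cone around the line spanned by `a`, of aperture `arcsin σ`. -/
def doubleCone (a : E) (σ : ℝ) : Set E := {z | (1 - σ ^ 2) * ‖z‖ ^ 2 < ⟪z, a⟫ ^ 2}

lemma isOpen_doubleCone (a : E) (σ : ℝ) : IsOpen (doubleCone a σ) :=
  isOpen_lt (by fun_prop) (by fun_prop)

lemma mem_doubleCone {a : E} {σ : ℝ} {z : E} :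
    z ∈ doubleCone a σ ↔ (1 - σ ^ 2) * ‖z‖ ^ 2 < ⟪z, a⟫ ^ 2 := Iff.rfl

lemma mem_doubleCone_iff (a : E) {σ : ℝ} (hσ : 0 < σ) (z : E) :
    z ∈ doubleCone a σ ↔ (1 - σ ^ 2) / σ ^ 2 * (‖z‖ ^ 2 - ⟪z, a⟫ ^ 2) < ⟪z, a⟫ ^ 2 := by
  have h : ⟪z, a⟫ ^ 2 - (1 - σ ^ 2) / σ ^ 2 * (‖z‖ ^ 2 - ⟪z, a⟫ ^ 2)
      = (⟪z, a⟫ ^ 2 - (1 - σ ^ 2) * ‖z‖ ^ 2) / σ ^ 2 := by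
    field_simp; ring
  have h2 : 0 < σ ^ 2 := by positivity
  rw [← sub_pos (a := ⟪z, a⟫ ^ 2), h, div_pos_iff_of_pos_right h2, sub_pos]
  rfl

lemma inv_sqrt_one_add {σ : ℝ} (hσ : 0 < σ) : (√(1 + (1 - σ ^ 2) / σ ^ 2))⁻¹ = σ := by
  have : 1 + (1 - σ ^ 2) / σ ^ 2 = (σ⁻¹) ^ 2 := by field_simp; ring
  rw [this, Real.sqrt_sq (by positivity), inv_inv]

lemma gaussianReal_abs_tail {s : ℝ} (hs : 0 ≤ s) :
    ENNReal.ofReal (√(2 / Real.pi)) * ENNReal.ofReal (Real.exp (-s / 2))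
      ≤ ∫⁻ g, Set.indicator {g : ℝ | s < g ^ 2} (fun g => ENNReal.ofReal |g|) g
        ∂(gaussianReal 0 1) := by
  have hms : MeasurableSet {g : ℝ | s < g ^ 2} := measurableSet_lt (by fun_prop) (by fun_prop)
  rw [lintegral_gaussianReal_eq ((by fun_prop : Measurable fun g : ℝ => ENNReal.ofReal |g|).indicator
    hms)]
  set F : ℝ → ℝ≥0∞ := fun g => ENNReal.ofReal ((√(2 * Real.pi))⁻¹ * Real.exp (-g ^ 2 / 2)) *
    Set.indicator {g : ℝ | s < g ^ 2} (fun g => ENNReal.ofReal |g|) g with hF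
  have hpos : ∫⁻ g in Set.Ioi (√s), F g
      = ENNReal.ofReal (√(2 * Real.pi))⁻¹ * ENNReal.ofReal (Real.exp (-s / 2)) := by
    rw [← lintegral_Ioi_mul_exp hs, ← lintegral_const_mul _ (by fun_prop)]
    refine setLIntegral_congr_fun measurableSet_Ioi fun r hr => ?_
    have h0 : 0 < r := (Real.sqrt_nonneg s).trans_lt hr
    have : s < r ^ 2 := (Real.sqrt_lt' h0).1 hr
    simp only [hF, Set.indicator, Set.mem_ofPred_eq, this, if_true, abs_of_pos h0]
    rw [← ENNReal.ofReal_mul (by positivity), ← ENNReal.ofReal_mul (by positivity)]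
    congr 1; ring
  have hneg : ∫⁻ g in Set.Iio (-√s), F g = ∫⁻ g in Set.Ioi (√s), F g := by
    have h := (Measure.measurePreserving_neg (volume : Measure ℝ)).setLIntegral_comp_preimage
      (s := Set.Iio (-√s)) measurableSet_Iio (f := F) (by
        refine Measurable.mul (by fun_prop) ?_
        exact (by fun_prop : Measurable fun g : ℝ => ENNReal.ofReal |g|).indicator hms)
    rw [← h]
    have hset : Neg.neg ⁻¹' Set.Iio (-√s) = Set.Ioi (√s) := by ext; simp
    rw [hset]
    refine lintegral_congr fun g => ?_
    simp [hF, Set.indicator]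
  calc ENNReal.ofReal (√(2 / Real.pi)) * ENNReal.ofReal (Real.exp (-s / 2))
      = (∫⁻ g in Set.Ioi (√s), F g) + ∫⁻ g in Set.Iio (-√s), F g := by
        rw [hneg, hpos, ← two_mul, ← mul_assoc]
        congr 1
        rw [show (2 : ℝ≥0∞) = ENNReal.ofReal 2 by simp, ← ENNReal.ofReal_mul (by norm_num)]
        congr 1
        rw [show 2 / Real.pi = 2 ^ 2 / (2 * Real.pi) by field_simp,
          Real.sqrt_div (by positivity), Real.sqrt_sq (by norm_num)]
        rfl
    _ = ∫⁻ g in Set.Ioi (√s) ∪ Set.Iio (-√s), F g := by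
        rw [lintegral_union measurableSet_Iio]
        rw [Set.disjoint_left]
        intro x hx hx'
        have h1 : √s < x := hx
        have h2 : x < -√s := hx'
        linarith [Real.sqrt_nonneg s]
    _ ≤ ∫⁻ g, F g := setLIntegral_le_lintegral _ _

lemma norm_sq_sub_inner_sq_nonneg {a : E} (ha : ‖a‖ = 1) (x : E) : 0 ≤ ‖x‖ ^ 2 - ⟪x, a⟫ ^ 2 := by
  have h : ‖x‖ ^ 2 - ⟪x, a⟫ ^ 2 = ‖x - ⟪x, a⟫ • a‖ ^ 2 := by
    rw [norm_sub_sq_real, norm_smul, inner_smul_right, ha]; simp; ring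
  rw [h]; positivity

/-- Lower bound for the Gaussian measure of a double cone. -/
lemma measure_doubleCone_ge {n : ℕ} {a : EuclideanSpace ℝ (Fin (n + 1))} (ha : ‖a‖ = 1) {σ : ℝ}
    (hσ : 0 < σ) (hσ1 : σ ≤ 1) :
    ENNReal.ofReal (√(2 / Real.pi) * σ ^ n) ≤ ENNReal.ofReal √(n + 1) *
      stdGaussian (EuclideanSpace ℝ (Fin (n + 1))) (doubleCone a σ) := by
  set γ := stdGaussian (EuclideanSpace ℝ (Fin (n + 1))) with hγ
  set k := (1 - σ ^ 2) / σ ^ 2 with hk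
  have hk0 : 0 ≤ k := div_nonneg (by nlinarith) (by positivity)
  have hm := (isOpen_doubleCone a σ).measurableSet
  have hfin : ∫⁻ z, ENNReal.ofReal ‖z‖ ∂γ ≠ ⊤ :=
    (lintegral_norm_stdGaussian_le.trans_lt ENNReal.ofReal_lt_top).ne
  have h1 := lintegral_norm_cone (μ := γ) (fun L => stdGaussian_map L) stdGaussian_singleton_zero
    hfin hm (by
      intro z hz
      have hz' : 0 < ‖z‖ := norm_pos_iff.2 hz
      simp only [doubleCone, Set.mem_ofPred_eq, radialProj, norm_smul, inner_smul_left]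
      simp only [norm_inv, norm_norm, RCLike.conj_to_real, mul_pow]
      rw [show (1 - σ ^ 2) * ((‖z‖⁻¹) ^ 2 * ‖z‖ ^ 2) = (‖z‖⁻¹) ^ 2 * ((1 - σ ^ 2) * ‖z‖ ^ 2) by ring]
      exact mul_lt_mul_iff_of_pos_left (by positivity))
  have h2 : ∫⁻ z, (doubleCone a σ).indicator (fun z => ENNReal.ofReal |⟪z, a⟫|) z ∂γ
      ≤ ∫⁻ z in doubleCone a σ, ENNReal.ofReal ‖z‖ ∂γ := by
    rw [lintegral_indicator hm]
    refine lintegral_mono fun z => ENNReal.ofReal_le_ofReal ?_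
    simpa [ha] using abs_real_inner_le_norm z a
  have h3 : ENNReal.ofReal (√(2 / Real.pi) * σ ^ n) ≤
      ∫⁻ z, (doubleCone a σ).indicator (fun z => ENNReal.ofReal |⟪z, a⟫|) z ∂γ := by
    rw [lintegral_gaussian_split ha
      ((by fun_prop : Measurable fun z => ENNReal.ofReal |⟪z, a⟫|).indicator hm),
      ENNReal.ofReal_mul (by positivity), ENNReal.ofReal_pow hσ.le]
    have := lintegral_exp_perp_one hk0 ha
    rw [inv_sqrt_one_add hσ] at this
    rw [← this, ← lintegral_const_mul _ (by fun_prop)]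
    refine lintegral_mono fun v => ?_
    have hs : 0 ≤ k * (‖v‖ ^ 2 - ⟪v, a⟫ ^ 2) :=
      mul_nonneg hk0 (norm_sq_sub_inner_sq_nonneg ha v)
    have := gaussianReal_abs_tail hs
    rw [neg_mul]
    refine this.trans (le_of_eq (lintegral_congr fun g => ?_))
    have hin : ⟪g • a + (v - ⟪v, a⟫ • a), a⟫ = g := by
      simp [inner_add_left, inner_sub_left, inner_smul_left, ha]
    have hno : ‖g • a + (v - ⟪v, a⟫ • a)‖ ^ 2 - g ^ 2 = ‖v‖ ^ 2 - ⟪v, a⟫ ^ 2 := by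
      rw [norm_add_sq_real, norm_sub_sq_real, norm_smul, norm_smul, inner_sub_right,
        inner_smul_right, inner_smul_right, inner_smul_left, inner_smul_left, ha,
        real_inner_comm v a]
      simp [ha]; ring
    have hmem : g • a + (v - ⟪v, a⟫ • a) ∈ doubleCone a σ ↔ k * (‖v‖ ^ 2 - ⟪v, a⟫ ^ 2) < g ^ 2 := by
      rw [mem_doubleCone_iff a hσ, hin, hno]
    simp only [Set.indicator, hmem, hin, Set.mem_ofPred_eq]
  exact h3.trans (h2.trans (h1.le.trans (mul_le_mul_left lintegral_norm_stdGaussian_le _)))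

end DoubleCone

section Hit

variable {n : ℕ}

local notation "𝔼" => EuclideanSpace ℝ (Fin (n + 1))

lemma stdGaussian_prod_rot {c s : ℝ} (hcs : c ^ 2 + s ^ 2 = 1) {f : 𝔼 × 𝔼 → ℝ≥0∞}
    (hf : Measurable f) :
    ∫⁻ p, f (planeRot c s p) ∂((stdGaussian 𝔼).prod (stdGaussian 𝔼))
      = ∫⁻ p, f p ∂((stdGaussian 𝔼).prod (stdGaussian 𝔼)) :=
  lintegral_planeRot_of_charFun (fun t => charFun_stdGaussian t) hcs hf

/-- Pairs whose planar span meets the double cone. -/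
def hitSet (a : 𝔼) (σ : ℝ) : Set (𝔼 × 𝔼) :=
  {p | ∃ c s : ℝ, c ^ 2 + s ^ 2 = 1 ∧ (planeRot c s p).1 ∈ doubleCone a σ}

lemma isOpen_hitSet (a : 𝔼) (σ : ℝ) : IsOpen (hitSet a σ) := by
  have : hitSet a σ = ⋃ c : ℝ, ⋃ s : ℝ, ⋃ _ : c ^ 2 + s ^ 2 = 1,
      (fun p : 𝔼 × 𝔼 => (planeRot c s p).1) ⁻¹' doubleCone a σ := by
    ext p; simp [hitSet]
  rw [this]
  refine isOpen_iUnion fun c => isOpen_iUnion fun s => isOpen_iUnion fun _ => ?_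
  exact (isOpen_doubleCone a σ).preimage (continuous_fst.comp (continuous_planeRot c s))

lemma planeRot_planeRot (c s c' s' : ℝ) (p : 𝔼 × 𝔼) :
    planeRot c s (planeRot c' s' p) = planeRot (c * c' - s * s') (c * s' + s * c') p := by
  simp only [planeRot, Prod.mk.injEq]
  constructor <;> module

lemma planeRot_mem_hitSet {a : 𝔼} {σ : ℝ} {c s : ℝ} (hcs : c ^ 2 + s ^ 2 = 1) (p : 𝔼 × 𝔼) :
    planeRot c s p ∈ hitSet a σ ↔ p ∈ hitSet a σ := by
  constructor
  · rintro ⟨c', s', h, hm⟩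
    rw [planeRot_planeRot] at hm
    refine ⟨_, _, ?_, hm⟩
    linear_combination (c' ^ 2 + s' ^ 2) * hcs + h
  · rintro ⟨c', s', h, hm⟩
    refine ⟨c' * c + s' * s, s' * c - c' * s, ?_, ?_⟩
    · linear_combination (c' ^ 2 + s' ^ 2) * hcs + h
    · rw [planeRot_planeRot]
      convert hm using 3
      · linear_combination c' * hcs
      · linear_combination s' * hcs

lemma lintegral_gaussian_split_pair {a : 𝔼} (ha : ‖a‖ = 1) {f : 𝔼 × 𝔼 → ℝ≥0∞}
    (hf : Measurable f) :
    ∫⁻ p, f p ∂((stdGaussian 𝔼).prod (stdGaussian 𝔼)) =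
      ∫⁻ q, ∫⁻ p, f (q.1 • a + (p.1 - ⟪p.1, a⟫ • a), q.2 • a + (p.2 - ⟪p.2, a⟫ • a))
        ∂((stdGaussian 𝔼).prod (stdGaussian 𝔼)) ∂((gaussianReal 0 1).prod (gaussianReal 0 1)) := by
  set γ := stdGaussian 𝔼
  set G := gaussianReal 0 1
  set φ : ℝ × 𝔼 → 𝔼 := fun p => p.1 • a + (p.2 - ⟪p.2, a⟫ • a) with hφ
  have hφm : Measurable φ := by fun_prop
  have hγ : (G.prod γ).map φ = γ := map_gaussian_split ha
  have h1 : ∫⁻ p, f p ∂(γ.prod γ) = ∫⁻ r, f (φ r.1, φ r.2) ∂((G.prod γ).prod (G.prod γ)) := by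
    conv_lhs => rw [← hγ, Measure.map_prod_map _ _ hφm hφm]
    rw [lintegral_map hf (by fun_prop)]
    rfl
  have hm1 : Measurable fun r : (ℝ × 𝔼) × (ℝ × 𝔼) => f (φ r.1, φ r.2) := by fun_prop
  rw [h1, lintegral_prod _ hm1.aemeasurable,
    lintegral_prod _ (Measurable.lintegral_prod_right' hm1).aemeasurable]
  have h2 : ∀ g : ℝ, ∫⁻ v, ∫⁻ y, f (φ (g, v), φ y) ∂(G.prod γ) ∂γ
      = ∫⁻ h, ∫⁻ p, f (φ (g, p.1), φ (h, p.2)) ∂(γ.prod γ) ∂G := by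
    intro g
    have hm2 : ∀ v, Measurable fun y : ℝ × 𝔼 => f (φ (g, v), φ y) := fun v => by fun_prop
    simp_rw [fun v => lintegral_prod _ (μ := G) (ν := γ) (hm2 v).aemeasurable]
    have hm3 : Measurable fun q : (𝔼 × ℝ) × 𝔼 => f (φ (g, q.1.1), φ (q.1.2, q.2)) := by fun_prop
    rw [lintegral_lintegral_swap hm3.lintegral_prod_right'.aemeasurable]
    refine lintegral_congr fun h => ?_
    rw [lintegral_prod _ (by fun_prop)]
  simp_rw [h2]
  have hm4 : Measurable fun r : (ℝ × ℝ) × (𝔼 × 𝔼) => f (φ (r.1.1, r.2.1), φ (r.1.2, r.2.2)) := by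
    fun_prop
  rw [lintegral_prod _ hm4.lintegral_prod_right'.aemeasurable]

lemma exists_unit_perp (hn : 1 ≤ n) {a : 𝔼} (ha : ‖a‖ = 1) : ∃ b : 𝔼, ‖b‖ = 1 ∧ ⟪b, a⟫ = 0 := by
  have h : (ℝ ∙ a)ᗮ ≠ ⊥ := by
    intro h
    have h1 : ℝ ∙ a = ⊤ := (Submodule.orthogonal_eq_bot_iff).1 h
    have h2 := finrank_span_singleton (K := ℝ) (v := a) (norm_ne_zero_iff.1 (by rw [ha]; exact one_ne_zero))
    rw [h1, finrank_top, finrank_euclideanSpace_fin] at h2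
    omega
  obtain ⟨x, hx, hx0⟩ := Submodule.exists_mem_ne_zero_of_ne_bot h
  refine ⟨‖x‖⁻¹ • x, by rw [norm_smul, norm_inv, norm_norm,
    inv_mul_cancel₀ (norm_ne_zero_iff.2 hx0)], ?_⟩
  rw [inner_smul_left, Submodule.mem_orthogonal_singleton_iff_inner_left.1 hx, mul_zero]

lemma norm_sq_sub_inner_sq_two {a b : 𝔼} (ha : ‖a‖ = 1) (hb : ‖b‖ = 1) (hab : ⟪b, a⟫ = 0) (x : 𝔼) :
    ‖x‖ ^ 2 - ⟪x, a⟫ ^ 2 - ⟪x, b⟫ ^ 2 = ‖x - ⟪x, a⟫ • a - ⟪x, b⟫ • b‖ ^ 2 := by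
  rw [norm_sub_sq_real, norm_sub_sq_real, norm_smul, norm_smul, inner_smul_right,
    inner_smul_right, inner_sub_left, inner_smul_left, real_inner_comm b a, hab, ha, hb]
  simp; ring

lemma hit_radius {a : 𝔼} (ha : ‖a‖ = 1) {σ : ℝ} (hσ : 0 < σ) (hσ1 : σ ≤ 1) {b : 𝔼} (hb : ‖b‖ = 1)
    (hab : ⟪b, a⟫ = 0) {r : ℝ} {v w : 𝔼} (t : ℝ) (hw : w - ⟪w, a⟫ • a = t • b)
    (h : (r • a + (v - ⟪v, a⟫ • a), (0 : ℝ) • a + (w - ⟪w, a⟫ • a)) ∈ hitSet a σ) :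
    (1 - σ ^ 2) / σ ^ 2 * (‖v‖ ^ 2 - ⟪v, a⟫ ^ 2 - ⟪v, b⟫ ^ 2) < r ^ 2 := by
  obtain ⟨c, s, hcs, hm⟩ := h
  set k := (1 - σ ^ 2) / σ ^ 2 with hk
  have hk0 : 0 ≤ k := div_nonneg (by nlinarith) (by positivity)
  rw [mem_doubleCone_iff a hσ] at hm
  have hx : (planeRot c s (r • a + (v - ⟪v, a⟫ • a), (0 : ℝ) • a + (w - ⟪w, a⟫ • a))).1
      = (c * r) • a + (c • (v - ⟪v, a⟫ • a) + (s * t) • b) := by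
    simp only [planeRot, hw]; module
  set x := (planeRot c s (r • a + (v - ⟪v, a⟫ • a), (0 : ℝ) • a + (w - ⟪w, a⟫ • a))).1
  have hxa : ⟪x, a⟫ = c * r := by
    rw [hx]; simp [inner_add_left, inner_sub_left, inner_smul_left, ha, hab]
  have hxb : ‖x‖ ^ 2 - ⟪x, a⟫ ^ 2 - ⟪x, b⟫ ^ 2
      = c ^ 2 * (‖v‖ ^ 2 - ⟪v, a⟫ ^ 2 - ⟪v, b⟫ ^ 2) := by
    have hab' : ⟪a, b⟫ = 0 := by rw [real_inner_comm]; exact hab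
    have hxb' : ⟪x, b⟫ = c * ⟪v, b⟫ + s * t := by
      rw [hx]; simp [inner_add_left, inner_sub_left, inner_smul_left, hb, hab']
    have hv : x - ⟪x, a⟫ • a - ⟪x, b⟫ • b = c • (v - ⟪v, a⟫ • a - ⟪v, b⟫ • b) := by
      rw [hxa, hxb', hx]
      module
    rw [norm_sq_sub_inner_sq_two ha hb hab, norm_sq_sub_inner_sq_two ha hb hab, hv, norm_smul,
      mul_pow, Real.norm_eq_abs, sq_abs]
  rw [hxa] at hm hxb
  have h1 : k * (c ^ 2 * (‖v‖ ^ 2 - ⟪v, a⟫ ^ 2 - ⟪v, b⟫ ^ 2)) < (c * r) ^ 2 := by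
    refine lt_of_le_of_lt (mul_le_mul_of_nonneg_left ?_ hk0) hm
    rw [← hxb]; nlinarith [sq_nonneg ⟪x, b⟫]
  by_contra hcon
  push Not at hcon
  nlinarith [mul_le_mul_of_nonneg_left hcon (sq_nonneg c)]

lemma measure_hitSet_le (hn : 1 ≤ n) {a : 𝔼} (ha : ‖a‖ = 1) {σ : ℝ} (hσ : 0 < σ) (hσ1 : σ ≤ 1) :
    ((stdGaussian 𝔼).prod (stdGaussian 𝔼)) (hitSet a σ) ≤ ENNReal.ofReal σ ^ (n - 1) := by
  set γ := stdGaussian 𝔼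
  set G := gaussianReal 0 1 with hG
  set k := (1 - σ ^ 2) / σ ^ 2 with hk
  have hk0 : 0 ≤ k := div_nonneg (by nlinarith) (by positivity)
  have hm : MeasurableSet (hitSet a σ) := (isOpen_hitSet a σ).measurableSet
  set f : 𝔼 × 𝔼 → ℝ≥0∞ := (hitSet a σ).indicator 1 with hf
  have hfm : Measurable f := measurable_one.indicator hm
  have hfrot : ∀ c s : ℝ, c ^ 2 + s ^ 2 = 1 → ∀ p, f (planeRot c s p) = f p := by
    intro c s hcs p
    by_cases hp : p ∈ hitSet a σ
    · rw [hf, Set.indicator_of_mem hp, Set.indicator_of_mem ((planeRot_mem_hitSet hcs p).2 hp)]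
      rfl
    · rw [hf, Set.indicator_of_notMem hp,
        Set.indicator_of_notMem (mt (planeRot_mem_hitSet hcs p).1 hp)]
  set F : ℝ → 𝔼 × 𝔼 → ℝ≥0∞ := fun r p =>
    f (r • a + (p.1 - ⟪p.1, a⟫ • a), (0 : ℝ) • a + (p.2 - ⟪p.2, a⟫ • a)) with hF
  have hFm : Measurable (Function.uncurry F) := by
    simp only [hF, Function.uncurry_def]; fun_prop
  rw [← lintegral_indicator_one hm, lintegral_gaussian_split_pair ha hfm]
  have hred : ∀ q : ℝ × ℝ, ∫⁻ p, f (q.1 • a + (p.1 - ⟪p.1, a⟫ • a),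
      q.2 • a + (p.2 - ⟪p.2, a⟫ • a)) ∂(γ.prod γ) = ∫⁻ p, F (√(q.1 ^ 2 + q.2 ^ 2)) p ∂(γ.prod γ) := by
    intro q
    set r := √(q.1 ^ 2 + q.2 ^ 2) with hr
    obtain ⟨c, s, hcs, h1, h2⟩ : ∃ c s : ℝ, c ^ 2 + s ^ 2 = 1 ∧ c * q.1 + s * q.2 = r ∧
        (-s) * q.1 + c * q.2 = 0 := by
      have hr2 : r ^ 2 = q.1 ^ 2 + q.2 ^ 2 := Real.sq_sqrt (by positivity)
      by_cases h0 : r = 0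
      · rw [h0] at hr2
        have h1 : q.1 = 0 := by nlinarith [sq_nonneg q.1, sq_nonneg q.2]
        have h2 : q.2 = 0 := by nlinarith [sq_nonneg q.1, sq_nonneg q.2]
        exact ⟨1, 0, by norm_num, by simp [h0, h1], by simp [h2]⟩
      · refine ⟨q.1 / r, q.2 / r, ?_, ?_, ?_⟩
        · field_simp; rw [hr2]
        · field_simp; rw [hr2]
        · field_simp; ring
    rw [← stdGaussian_prod_rot hcs (f := F r) (by fun_prop)]
    refine lintegral_congr fun p => ?_
    rw [← hfrot c s hcs]
    simp only [hF]
    congr 1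
    simp only [planeRot, Prod.mk.injEq, inner_add_left, inner_smul_left, ← h1]
    rw [← h2]
    simp only [RCLike.conj_to_real]
    constructor <;> module
  refine (lintegral_congr hred).trans_le ?_
  rw [lintegral_lintegral_swap (by
      have : Measurable fun x : (ℝ × ℝ) × (𝔼 × 𝔼) =>
        Function.uncurry F (√(x.1.1 ^ 2 + x.1.2 ^ 2), x.2) := hFm.comp (by fun_prop)
      exact this.aemeasurable)]
  have hm5 : Measurable fun x : (𝔼 × 𝔼) × (ℝ × ℝ) => F (√(x.2.1 ^ 2 + x.2.2 ^ 2)) x.1 := by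
    have : Measurable fun x : (𝔼 × 𝔼) × (ℝ × ℝ) =>
        Function.uncurry F (√(x.2.1 ^ 2 + x.2.2 ^ 2), x.1) := hFm.comp (by fun_prop)
    exact this
  rw [lintegral_prod_symm' _ hm5.lintegral_prod_right']
  obtain ⟨b₀, hb₀, hab₀⟩ := exists_unit_perp hn ha
  calc _ ≤ ∫⁻ _w : 𝔼, ENNReal.ofReal σ ^ (n - 1) ∂γ := lintegral_mono fun w => ?_
    _ = _ := by simp
  obtain ⟨b, t, hb, hab, hw⟩ : ∃ (b : 𝔼) (t : ℝ), ‖b‖ = 1 ∧ ⟪b, a⟫ = 0 ∧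
      w - ⟪w, a⟫ • a = t • b := by
    by_cases h0 : w - ⟪w, a⟫ • a = 0
    · exact ⟨b₀, 0, hb₀, hab₀, by simp [h0]⟩
    · refine ⟨‖w - ⟪w, a⟫ • a‖⁻¹ • (w - ⟪w, a⟫ • a), ‖w - ⟪w, a⟫ • a‖, ?_, ?_, ?_⟩
      · rw [norm_smul, norm_inv, norm_norm, inv_mul_cancel₀ (norm_ne_zero_iff.2 h0)]
      · simp [inner_smul_left, inner_sub_left, ha]
      · rw [smul_smul, mul_inv_cancel₀ (norm_ne_zero_iff.2 h0), one_smul]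
  have := lintegral_exp_perp_two hk0 ha hb hab hn
  rw [inv_sqrt_one_add hσ] at this
  rw [← this]
  refine lintegral_mono fun v => ?_
  have hD : 0 ≤ k * (‖v‖ ^ 2 - ⟪v, a⟫ ^ 2 - ⟪v, b⟫ ^ 2) := by
    rw [norm_sq_sub_inner_sq_two ha hb hab]; positivity
  rw [neg_mul, ← gaussianReal_radius_tail _ hD]
  have hms : MeasurableSet {r : ℝ | k * (‖v‖ ^ 2 - ⟪v, a⟫ ^ 2 - ⟪v, b⟫ ^ 2) < r ^ 2} :=
    measurableSet_lt (by fun_prop) (by fun_prop)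
  have hm6 : Measurable fun q : ℝ × ℝ => Set.indicator
      {r : ℝ | k * (‖v‖ ^ 2 - ⟪v, a⟫ ^ 2 - ⟪v, b⟫ ^ 2) < r ^ 2} (1 : ℝ → ℝ≥0∞)
      (√(q.1 ^ 2 + q.2 ^ 2)) := (measurable_one.indicator hms).comp (by fun_prop)
  rw [← lintegral_prod _ hm6.aemeasurable]
  refine lintegral_mono fun q => ?_
  simp only [hF, hf]
  by_cases hh : (√(q.1 ^ 2 + q.2 ^ 2) • a + (v - ⟪v, a⟫ • a), (0 : ℝ) • a + (w - ⟪w, a⟫ • a))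
      ∈ hitSet a σ
  · have hr := hit_radius ha hσ hσ1 hb hab t hw hh
    rw [Set.indicator_of_mem hh, Set.indicator_of_mem (by exact hr)]
    rfl
  · rw [Set.indicator_of_notMem hh]
    exact bot_le

end Hit

section CircleAveraging

/-- The uniform probability measure on one period of the angle. -/
noncomputable def angleMeasure : Measure ℝ :=
  (ENNReal.ofReal (2 * Real.pi))⁻¹ • volume.restrict (Set.Ioc 0 (2 * Real.pi))

instance : IsProbabilityMeasure angleMeasure := by
  constructor
  have h : (0 : ℝ) < 2 * Real.pi := by positivity
  simp only [angleMeasure, Measure.smul_apply, Measure.restrict_apply MeasurableSet.univ,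
    Set.univ_inter, Real.volume_Ioc, sub_zero, smul_eq_mul]
  exact ENNReal.inv_mul_cancel (by simpa using h) ENNReal.ofReal_ne_top

lemma lintegral_angleMeasure (f : ℝ → ℝ≥0∞) :
    ∫⁻ θ, f θ ∂angleMeasure
      = (ENNReal.ofReal (2 * Real.pi))⁻¹ * ∫⁻ θ in Set.Ioc 0 (2 * Real.pi), f θ := by
  simp [angleMeasure, lintegral_smul_measure]

lemma setLIntegral_Ioc_add {f : ℝ → ℝ≥0∞} {T : ℝ} (hT : 0 < T) (hf : Function.Periodic f T)
    (b τ : ℝ) : ∫⁻ θ in Set.Ioc b (b + T), f (θ + τ) = ∫⁻ θ in Set.Ioc 0 T, f θ := by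
  have h1 := (measurePreserving_add_right (volume : Measure ℝ) τ).setLIntegral_comp_preimage_emb
    (measurableEmbedding_addRight τ) f (Set.Ioc (b + τ) (b + τ + T))
  have h2 : (fun x : ℝ => x + τ) ⁻¹' Set.Ioc (b + τ) (b + τ + T) = Set.Ioc b (b + T) := by
    ext x; simp only [Set.mem_preimage, Set.mem_Ioc]
    constructor <;> rintro ⟨h, h'⟩ <;> constructor <;> linarith
  rw [h2] at h1
  rw [h1]
  have h3 := (isAddFundamentalDomain_Ioc hT (b + τ) volume).setLIntegral_eq
    (isAddFundamentalDomain_Ioc hT 0 volume) f ?_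
  · simpa using h3
  · rintro ⟨g, hg⟩ x
    obtain ⟨m, rfl⟩ := AddSubgroup.mem_zmultiples_iff.1 hg
    have := hf.zsmul m
    simpa [add_comm, AddSubmonoid.vadd_def, AddSubgroup.vadd_def] using this x

lemma lintegral_angleMeasure_add {f : ℝ → ℝ≥0∞} (hf : Function.Periodic f (2 * Real.pi))
    (τ : ℝ) : ∫⁻ θ, f (θ + τ) ∂angleMeasure = ∫⁻ θ, f θ ∂angleMeasure := by
  rw [lintegral_angleMeasure, lintegral_angleMeasure]
  congr 1
  simpa using setLIntegral_Ioc_add (by positivity) hf 0 τ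

open Polynomial

/-- The gap `M - log x`, infinite at `x = 0`. -/
noncomputable def logGap (M x : ℝ) : ℝ≥0∞ :=
  if x = 0 then ⊤ else ENNReal.ofReal (M - Real.log x)

lemma measurable_logGap (M : ℝ) : Measurable (logGap M) :=
  Measurable.ite (measurableSet_singleton 0) measurable_const (by fun_prop)

lemma ae_eval_circleMap_ne_zero {p : ℂ[X]} (hp : p ≠ 0) :
    ∀ᵐ θ : ℝ, p.eval (circleMap 0 1 θ) ≠ 0 := by
  have h : {θ : ℝ | p.eval (circleMap 0 1 θ) = 0} = circleMap 0 1 ⁻¹' (p.roots.toFinset : Set ℂ) := by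
    ext θ; simp [hp]
  have hc : ({θ : ℝ | p.eval (circleMap 0 1 θ) = 0}).Countable := by
    rw [h]
    exact (Finset.countable_toSet _).preimage_circleMap 0 one_ne_zero
  have := hc.measure_zero volume
  rw [ae_iff]; simpa using this

lemma lintegral_ofReal_angleMeasure {f : ℝ → ℝ}
    (hf : IntervalIntegrable f volume 0 (2 * Real.pi)) (h0 : ∀ᵐ θ : ℝ, 0 ≤ f θ) :
    ∫⁻ θ, ENNReal.ofReal (f θ) ∂angleMeasure
      = ENNReal.ofReal ((2 * Real.pi)⁻¹ * ∫ θ in (0 : ℝ)..(2 * Real.pi), f θ) := by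
  have hpi : (0 : ℝ) < 2 * Real.pi := by positivity
  rw [lintegral_angleMeasure, ENNReal.ofReal_mul (inv_nonneg.2 hpi.le), ENNReal.ofReal_inv_of_pos hpi,
    intervalIntegral.integral_of_le hpi.le, ofReal_integral_eq_lintegral_ofReal]
  · exact (intervalIntegrable_iff_integrableOn_Ioc_of_le hpi.le).1 hf
  · exact ae_restrict_of_ae h0

lemma lintegral_logGap_eval {p : ℂ[X]} (hp : p ≠ 0) {M : ℝ}
    (hM : ∀ θ : ℝ, ‖p.eval (circleMap 0 1 θ)‖ ≤ Real.exp M) :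
    ∫⁻ θ, logGap M ‖p.eval (circleMap 0 1 θ)‖ ∂angleMeasure
      = ENNReal.ofReal (M - p.logMahlerMeasure) := by
  have hae := ae_eval_circleMap_ne_zero hp
  have hii := p.intervalIntegrable_mahlerMeasure
  calc ∫⁻ θ, logGap M ‖p.eval (circleMap 0 1 θ)‖ ∂angleMeasure
      = ∫⁻ θ, ENNReal.ofReal (M - Real.log ‖p.eval (circleMap 0 1 θ)‖) ∂angleMeasure := by
        rw [lintegral_angleMeasure, lintegral_angleMeasure]
        congr 1
        refine lintegral_congr_ae (ae_restrict_of_ae ?_)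
        filter_upwards [hae] with θ hθ
        simp [logGap, hθ]
    _ = _ := by
        rw [lintegral_ofReal_angleMeasure (intervalIntegrable_const.sub hii)]
        · rw [intervalIntegral.integral_sub intervalIntegrable_const hii,
            logMahlerMeasure_def, Real.circleAverage_def]
          congr 1
          simp only [intervalIntegral.integral_const, smul_eq_mul]
          field_simp
          ring
        · filter_upwards [hae] with θ hθ
          have := Real.log_le_log (norm_pos_iff.2 hθ) (hM θ)
          rw [Real.log_exp] at this
          linarith

lemma logMahlerMeasure_le {p : ℂ[X]} (hp : p ≠ 0) {M : ℝ}
    (hM : ∀ θ : ℝ, ‖p.eval (circleMap 0 1 θ)‖ ≤ Real.exp M) : p.logMahlerMeasure ≤ M := by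
  have hpi : (0 : ℝ) < 2 * Real.pi := by positivity
  have h := intervalIntegral.integral_mono_ae (μ := volume) hpi.le p.intervalIntegrable_mahlerMeasure
    (intervalIntegrable_const (c := M)) (by
      filter_upwards [ae_eval_circleMap_ne_zero hp] with θ hθ
      have := Real.log_le_log (norm_pos_iff.2 hθ) (hM θ)
      rwa [Real.log_exp] at this)
  rw [logMahlerMeasure_def, Real.circleAverage_def, smul_eq_mul, inv_mul_le_iff₀ hpi]
  simpa using h

lemma log_norm_eval_zero_le_logMahlerMeasure {p : ℂ[X]} (h0 : p.eval 0 ≠ 0) :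
    Real.log ‖p.eval 0‖ ≤ p.logMahlerMeasure := by
  have := p.norm_coeff_le_choose_mul_mahlerMeasure 0
  rw [logMahlerMeasure_eq_log_MahlerMeasure]
  refine Real.log_le_log (norm_pos_iff.2 h0) ?_
  simpa [coeff_zero_eq_eval_zero] using this

lemma lintegral_logGap_eval_le (p : ℂ[X]) {M : ℝ}
    (hM : ∀ θ : ℝ, ‖p.eval (circleMap 0 1 θ)‖ ≤ Real.exp M) :
    ∫⁻ θ, logGap M ‖p.eval (circleMap 0 1 θ)‖ ∂angleMeasure ≤ logGap M ‖p.eval 0‖ := by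
  by_cases h0 : p.eval 0 = 0
  · simp [logGap, h0]
  · have hp : p ≠ 0 := by rintro rfl; simp at h0
    rw [lintegral_logGap_eval hp hM]
    simp only [logGap, norm_eq_zero, h0, if_false]
    exact ENNReal.ofReal_le_ofReal (by linarith [log_norm_eval_zero_le_logMahlerMeasure h0])

lemma lintegral_logGap_eval_add_le (p : ℂ[X]) {M : ℝ} {ζ : ℂ} (hζ : p.eval ζ = 0)
    (hM : ∀ θ : ℝ, ‖p.eval (circleMap 0 1 θ)‖ ≤ Real.exp M) :
    (∫⁻ θ, logGap M ‖p.eval (circleMap 0 1 θ)‖ ∂angleMeasure)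
      + ENNReal.ofReal (Real.posLog ‖ζ‖⁻¹) ≤ logGap M ‖p.eval 0‖ := by
  by_cases h0 : p.eval 0 = 0
  · simp [logGap, h0]
  · have hp : p ≠ 0 := by rintro rfl; simp at h0
    obtain ⟨q, rfl⟩ := dvd_iff_isRoot.2 hζ
    have hq0 : q.eval 0 ≠ 0 := by intro h; simp [h] at h0
    have hζ0 : ζ ≠ 0 := by rintro rfl; simp at h0
    have h1 := log_norm_eval_zero_le_logMahlerMeasure hq0
    have h2 := Real.posLog_sub_posLog_inv (x := ‖ζ‖)
    have h3 : ((X - C ζ) * q).logMahlerMeasure - Real.log ‖((X - C ζ) * q).eval 0‖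
        ≥ Real.posLog ‖ζ‖⁻¹ := by
      rw [logMahlerMeasure_mul_eq_add_logMahlerMeasure hp, logMahlerMeasure_X_sub_C, eval_mul,
        norm_mul, Real.log_mul (by simpa using hζ0) (by simpa using hq0)]
      simp only [eval_sub, eval_X, eval_C, zero_sub, norm_neg]
      linarith
    have h4 := logMahlerMeasure_le hp hM
    rw [lintegral_logGap_eval hp hM, ← ENNReal.ofReal_add (by linarith) Real.posLog_nonneg]
    simp only [logGap, norm_eq_zero, h0, if_false]
    exact ENNReal.ofReal_le_ofReal (by linarith)

end CircleAveraging

section AngleIntegral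

open Real (posLog)

lemma lintegral_posLog_div_abs {R : ℝ} (hR : 0 < R) :
    ∫⁻ x : ℝ, ENNReal.ofReal (posLog (R / |x|)) ≤ ENNReal.ofReal (2 * R) := by
  have h1 : ∫⁻ x : ℝ, ENNReal.ofReal (posLog (R / |x|))
      ≤ ∫⁻ x in Set.Ioc (-R) R, ENNReal.ofReal (Real.log R - Real.log x) := by
    rw [← lintegral_indicator measurableSet_Ioc]
    refine lintegral_mono_ae ?_
    have h0 : ∀ᵐ x : ℝ, x ≠ 0 := by simp [ae_iff]
    have h0' : ∀ᵐ x : ℝ, x ≠ -R := by simp [ae_iff]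
    filter_upwards [h0, h0'] with x hx hx'
    by_cases h : |x| ≤ R
    · have hm : x ∈ Set.Ioc (-R) R :=
        ⟨lt_of_le_of_ne (abs_le.1 h).1 (Ne.symm hx'), (abs_le.1 h).2⟩
      rw [Set.indicator_of_mem hm, Real.posLog_eq_log, Real.log_div hR.ne' (by simpa using hx),
        Real.log_abs]
      rw [abs_of_pos (by positivity), one_le_div (by positivity)]
      exact h
    · have : posLog (R / |x|) = 0 := by
        rw [Real.posLog_eq_zero_iff, abs_of_nonneg (by positivity)]
        exact div_le_one_of_le₀ (le_of_not_ge h) (abs_nonneg x)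
      simp [this]
  refine h1.trans ?_
  have hle : -R ≤ R := by linarith
  have hintegr : IntervalIntegrable (fun x => Real.log R - Real.log x) volume (-R) R :=
    intervalIntegrable_const.sub intervalIntegral.intervalIntegrable_log'
  rw [← ofReal_integral_eq_lintegral_ofReal]
  · refine ENNReal.ofReal_le_ofReal ?_
    rw [← intervalIntegral.integral_of_le hle, intervalIntegral.integral_sub
      intervalIntegrable_const intervalIntegral.intervalIntegrable_log', integral_log]
    simp only [intervalIntegral.integral_const, smul_eq_mul, Real.log_neg_eq_log]
    linarith
  · exact (intervalIntegrable_iff_integrableOn_Ioc_of_le hle).1 hintegr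
  · have h0 : ∀ᵐ x : ℝ, x ≠ 0 := by simp [ae_iff]
    filter_upwards [ae_restrict_of_ae h0, ae_restrict_mem measurableSet_Ioc] with x hx hm
    have : Real.log |x| ≤ Real.log R :=
      Real.log_le_log (by positivity) (abs_le.2 ⟨hm.1.le, hm.2⟩)
    rw [Real.log_abs] at this
    simpa using this

lemma abs_cot_le {x : ℝ} (h1 : -(Real.pi / 2) < x) (h2 : x < Real.pi / 2) :
    |Real.cos x / Real.sin x| ≤ 1 / |x| := by
  rcases eq_or_ne x 0 with rfl | hx
  · simp
  have key : ∀ y : ℝ, 0 < y → y < Real.pi / 2 → Real.cos y / Real.sin y ≤ 1 / y := by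
    intro y hy hy2
    have hs := Real.sin_pos_of_pos_of_lt_pi hy (by linarith)
    have hc := Real.cos_pos_of_mem_Ioo ⟨by linarith, hy2⟩
    have ht := (Real.lt_tan hy hy2).le
    rw [Real.tan_eq_sin_div_cos, le_div_iff₀ hc] at ht
    rw [div_le_div_iff₀ hs hy]
    linarith
  have h3 : |Real.cos x / Real.sin x| = Real.cos |x| / Real.sin |x| := by
    have hy : 0 < |x| := abs_pos.2 hx
    have hy2 : |x| < Real.pi / 2 := abs_lt.2 ⟨h1, h2⟩
    have hs := Real.sin_pos_of_pos_of_lt_pi hy (by linarith)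
    have hc := Real.cos_pos_of_mem_Ioo ⟨by linarith, hy2⟩
    rw [abs_div, Real.cos_abs]
    rw [Real.cos_abs] at hc
    rw [abs_of_pos hc]
    congr 1
    rcases abs_cases x with ⟨h, _⟩ | ⟨h, _⟩ <;> rw [h] at hs ⊢
    · exact abs_of_pos hs
    · rw [Real.sin_neg] at hs ⊢
      exact abs_of_neg (by linarith)
  rw [h3]
  exact key _ (abs_pos.2 hx) (abs_lt.2 ⟨h1, h2⟩)

lemma lintegral_posLog_tan {R : ℝ} (hR : 0 < R) (θ₀ : ℝ) :
    ∫⁻ θ, ENNReal.ofReal (posLog (R * |Real.tan (θ - θ₀)|)) ∂angleMeasure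
      ≤ ENNReal.ofReal (2 * R / Real.pi) := by
  set f : ℝ → ℝ≥0∞ := fun θ => ENNReal.ofReal (posLog (R * |Real.cos θ / Real.sin θ|)) with hf
  have hpi := Real.pi_pos
  have hper : Function.Periodic f Real.pi := by
    intro θ
    simp only [hf, Real.cos_add_pi, Real.sin_add_pi, neg_div_neg_eq]
  have hper2 : Function.Periodic f (2 * Real.pi) := by simpa using hper.nsmul 2
  have h1 : ∀ θ, ENNReal.ofReal (posLog (R * |Real.tan (θ - θ₀)|))
      = f (θ + (Real.pi / 2 - θ₀)) := by
    intro θ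
    simp only [hf]
    rw [show θ + (Real.pi / 2 - θ₀) = (θ - θ₀) + Real.pi / 2 by ring, Real.cos_add_pi_div_two,
      Real.sin_add_pi_div_two, Real.tan_eq_sin_div_cos, neg_div, abs_neg]
  rw [lintegral_congr h1, lintegral_angleMeasure_add hper2, lintegral_angleMeasure]
  have h2 : ∫⁻ θ in Set.Ioc (-(Real.pi / 2)) (-(Real.pi / 2) + Real.pi), f θ
      ≤ ENNReal.ofReal (2 * R) := by
    refine le_trans ?_ (lintegral_posLog_div_abs hR)
    refine le_trans (lintegral_mono_ae ?_) (setLIntegral_le_lintegral _ _)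
    have h0 : ∀ᵐ x : ℝ, x ≠ Real.pi / 2 := by simp [ae_iff]
    filter_upwards [ae_restrict_of_ae h0, ae_restrict_mem measurableSet_Ioc] with x hx hm
    refine ENNReal.ofReal_le_ofReal (Real.posLog_le_posLog (by positivity) ?_)
    have := abs_cot_le hm.1 (lt_of_le_of_ne (by linarith [hm.2]) hx)
    calc R * |Real.cos x / Real.sin x| ≤ R * (1 / |x|) := by gcongr
      _ = R / |x| := by ring
  have h3 := setLIntegral_Ioc_add hpi hper (-(Real.pi / 2)) 0
  have h4 := setLIntegral_Ioc_add hpi hper Real.pi 0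
  simp only [add_zero] at h3 h4
  have h5 : Set.Ioc 0 (2 * Real.pi) = Set.Ioc 0 Real.pi ∪ Set.Ioc Real.pi (Real.pi + Real.pi) := by
    rw [Set.Ioc_union_Ioc_eq_Ioc hpi.le (by linarith), two_mul]
  have h6 : ∫⁻ θ in Set.Ioc 0 (2 * Real.pi), f θ ≤ ENNReal.ofReal (4 * R) := by
    rw [h5]
    refine (lintegral_union_le _ _ _).trans ?_
    rw [h4, ← h3]
    refine (add_le_add h2 h2).trans ?_
    rw [← ENNReal.ofReal_add (by positivity) (by positivity)]
    exact ENNReal.ofReal_le_ofReal (by linarith)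
  calc _ ≤ (ENNReal.ofReal (2 * Real.pi))⁻¹ * ENNReal.ofReal (4 * R) := by gcongr
    _ = ENNReal.ofReal (2 * R / Real.pi) := by
      rw [← ENNReal.ofReal_inv_of_pos (by positivity), ← ENNReal.ofReal_mul (by positivity)]
      congr 1; field_simp; ring

/-- The form `α x + β y` in polar form. -/
lemma exists_norm_sq_linear_form (α β : ℂ) : ∃ A B θ₀ : ℝ, 0 ≤ B ∧ B ≤ A ∧ ∀ θ : ℝ,
    ‖α * Real.cos θ + β * Real.sin θ‖ ^ 2 = (A - B) + 2 * B * Real.cos (θ - θ₀) ^ 2 ∧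
    ‖-(α * Real.sin θ) + β * Real.cos θ‖ ^ 2 = (A - B) + 2 * B * Real.sin (θ - θ₀) ^ 2 := by
  set x := (‖α‖ ^ 2 - ‖β‖ ^ 2) / 2 with hx
  set y := α.re * β.re + α.im * β.im with hy
  set w : ℂ := ⟨x, y⟩
  have hα : ‖α‖ ^ 2 = α.re ^ 2 + α.im ^ 2 := by rw [← Complex.normSq_eq_norm_sq, Complex.normSq_apply]; ring
  have hβ : ‖β‖ ^ 2 = β.re ^ 2 + β.im ^ 2 := by rw [← Complex.normSq_eq_norm_sq, Complex.normSq_apply]; ring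
  have hw : ‖w‖ ^ 2 = x ^ 2 + y ^ 2 := by
    rw [← Complex.normSq_eq_norm_sq, Complex.normSq_apply]; ring
  have h1 : ‖w‖ * Real.cos w.arg = x := Complex.norm_mul_cos_arg w
  have h2 : ‖w‖ * Real.sin w.arg = y := Complex.norm_mul_sin_arg w
  have hc : Real.cos w.arg = 2 * Real.cos (w.arg / 2) ^ 2 - 1 := by
    rw [← Real.cos_two_mul]; congr 1; ring
  have hs : Real.sin w.arg = 2 * Real.sin (w.arg / 2) * Real.cos (w.arg / 2) := by
    rw [← Real.sin_two_mul]; congr 1; ring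
  refine ⟨(‖α‖ ^ 2 + ‖β‖ ^ 2) / 2, ‖w‖, w.arg / 2, norm_nonneg _, ?_, fun θ => ?_⟩
  · refine abs_le_of_sq_le_sq' ?_ (by positivity) |>.2
    rw [hw, hx, hy, hα, hβ]
    nlinarith [sq_nonneg (α.re * β.im - α.im * β.re)]
  · have e1 := Real.sin_sq_add_cos_sq (w.arg / 2)
    have e2 := Real.sin_sq_add_cos_sq θ
    set C := Real.cos (w.arg / 2)
    set D := Real.sin (w.arg / 2)
    rw [hc] at h1
    rw [hs] at h2
    rw [Real.cos_sub, Real.sin_sub]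
    constructor
    · rw [← Complex.normSq_eq_norm_sq, Complex.normSq_apply]
      simp only [Complex.add_re, Complex.add_im, Complex.mul_re, Complex.mul_im,
        Complex.ofReal_re, Complex.ofReal_im]
      linear_combination (-Real.cos θ ^ 2) * hα - Real.sin θ ^ 2 * hβ - (Real.cos θ ^ 2 - Real.sin θ ^ 2) * h1 - 2 * Real.cos θ * Real.sin θ * h2 - 2 * ‖w‖ * Real.sin θ ^ 2 * e1 + ((‖α‖ ^ 2 + ‖β‖ ^ 2) / 2 - ‖w‖) * e2
    · rw [← Complex.normSq_eq_norm_sq, Complex.normSq_apply]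
      simp only [Complex.add_re, Complex.add_im, Complex.mul_re, Complex.mul_im,
        Complex.ofReal_re, Complex.ofReal_im, Complex.neg_re, Complex.neg_im]
      linear_combination (-Real.sin θ ^ 2) * hα - Real.cos θ ^ 2 * hβ + (Real.cos θ ^ 2 - Real.sin θ ^ 2) * h1 + 2 * Real.cos θ * Real.sin θ * h2 - 2 * ‖w‖ * Real.cos θ ^ 2 * e1 + ((‖α‖ ^ 2 + ‖β‖ ^ 2) / 2 - ‖w‖) * e2

lemma lintegral_posLog_linear_form {R : ℝ} (hR : 0 < R) (hR1 : R ≤ 1) (α β : ℂ) :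
    ∫⁻ θ : ℝ, ENNReal.ofReal (posLog (R * ‖-(α * Real.sin θ) + β * Real.cos θ‖ /
      ‖α * Real.cos θ + β * Real.sin θ‖)) ∂angleMeasure ≤ ENNReal.ofReal (2 * R / Real.pi) := by
  obtain ⟨A, B, θ₀, hB, hBA, h⟩ := exists_norm_sq_linear_form α β
  refine le_trans (lintegral_mono_ae ?_) (lintegral_posLog_tan hR θ₀)
  have hae : ∀ᵐ θ : ℝ ∂angleMeasure, Real.cos (θ - θ₀) ≠ 0 := by
    have hc : ({θ : ℝ | Real.cos (θ - θ₀) = 0}).Countable := by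
      refine (Set.countable_range fun m : ℤ => (2 * (m : ℝ) + 1) * Real.pi / 2 + θ₀).mono ?_
      intro θ hθ
      obtain ⟨m, hm⟩ := Real.cos_eq_zero_iff.1 hθ
      exact ⟨m, by simp only; linarith⟩
    have h0 : ∀ᵐ θ : ℝ, Real.cos (θ - θ₀) ≠ 0 := by
      rw [ae_iff]; simpa using hc.measure_zero volume
    exact Measure.ae_smul_measure (ae_restrict_of_ae h0) _
  filter_upwards [hae] with θ hθ
  refine ENNReal.ofReal_le_ofReal ?_
  set T := R * |Real.tan (θ - θ₀)| with hT
  have hT0 : 0 ≤ T := by positivity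
  have hmax : posLog (max 1 T) = posLog T := by
    rw [Real.posLog_eq_log_max_one (le_max_of_le_left zero_le_one), Real.posLog_eq_log_max_one hT0,
      ← max_assoc, max_self]
  rw [← hmax]
  refine Real.posLog_le_posLog (by positivity) ?_
  refine div_le_of_le_mul₀ (norm_nonneg _) (le_max_of_le_left zero_le_one) ?_
  refine abs_le_of_sq_le_sq' ?_ (mul_nonneg (le_max_of_le_left zero_le_one) (norm_nonneg _)) |>.2
  rw [mul_pow, mul_pow, (h θ).1, (h θ).2]
  have hm1 : (1 : ℝ) ≤ max 1 T ^ 2 := one_le_pow₀ (le_max_left _ _)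
  have hm2 : T ^ 2 ≤ max 1 T ^ 2 := pow_le_pow_left₀ hT0 (le_max_right _ _) 2
  have hR2 : R ^ 2 ≤ 1 := pow_le_one₀ hR.le hR1
  have hts : T ^ 2 * Real.cos (θ - θ₀) ^ 2 = R ^ 2 * Real.sin (θ - θ₀) ^ 2 := by
    rw [hT, mul_pow, sq_abs, Real.tan_eq_sin_div_cos]; field_simp
  have h1 : R ^ 2 * (A - B) ≤ max 1 T ^ 2 * (A - B) :=
    mul_le_mul_of_nonneg_right (hR2.trans hm1) (by linarith)
  have h2 : T ^ 2 * Real.cos (θ - θ₀) ^ 2 ≤ max 1 T ^ 2 * Real.cos (θ - θ₀) ^ 2 :=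
    mul_le_mul_of_nonneg_right hm2 (sq_nonneg _)
  rw [hts] at h2
  nlinarith [mul_le_mul_of_nonneg_left h2 hB]

end AngleIntegral

section MahlerExcess

open Polynomial Real

/-- The excess of the logarithmic Mahler measure over `log ‖p 0‖` (zero if `p 0 = 0`). -/
noncomputable def mahlerExcess (p : ℂ[X]) : ℝ≥0∞ :=
  if p.eval 0 = 0 then 0 else ENNReal.ofReal (p.logMahlerMeasure - Real.log ‖p.eval 0‖)

lemma mahlerExcess_mul_le (p q : ℂ[X]) :
    mahlerExcess (p * q) ≤ mahlerExcess p + mahlerExcess q := by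
  by_cases hp : p.eval 0 = 0
  · simp [mahlerExcess, hp]
  by_cases hq : q.eval 0 = 0
  · simp [mahlerExcess, hq]
  have hp0 : p ≠ 0 := by rintro rfl; simp at hp
  have hq0 : q ≠ 0 := by rintro rfl; simp at hq
  simp only [mahlerExcess, eval_mul, mul_eq_zero, hp, hq, or_self, if_false]
  rw [logMahlerMeasure_mul_eq_add_logMahlerMeasure (mul_ne_zero hp0 hq0), norm_mul,
    Real.log_mul (by simpa using hp) (by simpa using hq)]
  refine le_trans (ENNReal.ofReal_le_ofReal ?_) ENNReal.ofReal_add_le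
  linarith

lemma mahlerExcess_C (a : ℂ) : mahlerExcess (C a) = 0 := by
  simp [mahlerExcess]

lemma mahlerExcess_linear_le (a b : ℂ) :
    mahlerExcess (C a + C b * X) ≤ ENNReal.ofReal (posLog (‖b‖ / ‖a‖)) := by
  by_cases ha : a = 0
  · simp [mahlerExcess, ha]
  by_cases hb : b = 0
  · simp [hb, mahlerExcess_C]
  simp only [mahlerExcess, eval_add, eval_mul, eval_C, eval_X, mul_zero, add_zero, ha, if_false]
  refine ENNReal.ofReal_le_ofReal ?_
  rw [add_comm (C a), logMahlerMeasure_C_mul_X_add_C hb]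
  have h := Real.posLog_sub_posLog_inv (x := ‖b‖ / ‖a‖)
  rw [Real.log_div (by simpa using hb) (by simpa using ha), inv_div] at h
  rw [norm_mul, norm_inv, inv_mul_eq_div]
  linarith

/-- The linear form `α x + β y` along the rotated frame. -/
noncomputable def linForm (R : ℝ) (q : ℂ × ℂ) (θ : ℝ) : ℂ[X] :=
  C (q.1 * cos θ + q.2 * sin θ) + C (R * (-(q.1 * sin θ) + q.2 * cos θ)) * X

lemma lintegral_mahlerExcess_prod_linForm {R : ℝ} (hR : 0 < R) (hR1 : R ≤ 1)
    (L : Multiset (ℂ × ℂ)) :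
    ∫⁻ θ, mahlerExcess ((L.map fun q => linForm R q θ).prod) ∂angleMeasure
      ≤ Multiset.card L * ENNReal.ofReal (2 * R / Real.pi) := by
  induction L using Multiset.induction_on with
  | empty =>
    have : mahlerExcess 1 = 0 := by rw [← C_1]; exact mahlerExcess_C 1
    simp [this]
  | cons q L ih =>
    have hle : ∀ θ, mahlerExcess (((q ::ₘ L).map fun q => linForm R q θ).prod)
        ≤ ENNReal.ofReal (posLog (R * ‖-(q.1 * Real.sin θ) + q.2 * Real.cos θ‖ /
          ‖q.1 * Real.cos θ + q.2 * Real.sin θ‖))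
          + mahlerExcess ((L.map fun q => linForm R q θ).prod) := by
      intro θ
      rw [Multiset.map_cons, Multiset.prod_cons]
      refine (mahlerExcess_mul_le _ _).trans (add_le_add_left ?_ _)
      refine (mahlerExcess_linear_le _ _).trans_eq ?_
      rw [norm_mul, Complex.norm_real, Real.norm_of_nonneg hR.le]
    refine (lintegral_mono hle).trans ?_
    rw [lintegral_add_left]
    · refine (add_le_add (lintegral_posLog_linear_form hR hR1 q.1 q.2) ih).trans_eq ?_
      rw [Multiset.card_cons]; push_cast; ring
    · have hp : Measurable posLog := by
        unfold Real.posLog; fun_prop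
      refine ENNReal.measurable_ofReal.comp (hp.comp ?_)
      fun_prop

lemma MvPolynomial.IsHomogeneous.aeval_smul' {m k : ℕ} {P : MvPolynomial (Fin m) ℝ}
    (h : P.IsHomogeneous k) (x : ℂ) (f : Fin m → ℂ) :
    MvPolynomial.aeval (fun i => x * f i) P = x ^ k * MvPolynomial.aeval f P := by
  simp only [MvPolynomial.aeval_def, MvPolynomial.eval₂_eq, Finset.mul_sum]
  refine Finset.sum_congr rfl fun d hd => ?_
  have hk : ∑ i ∈ d.support, d i = k := by
    have := h (MvPolynomial.mem_support_iff.1 hd)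
    simpa [Finsupp.weight_apply, Finsupp.sum] using this
  simp only [mul_pow, Finset.prod_mul_distrib, Finset.prod_pow_eq_pow_sum, hk]
  ring

lemma eval_aeval_mvPolynomial {m : ℕ} (P : MvPolynomial (Fin m) ℝ) (f : Fin m → ℂ[X]) (s : ℂ) :
    (MvPolynomial.aeval f P).eval s = MvPolynomial.aeval (fun i => (f i).eval s) P := by
  have := MvPolynomial.comp_aeval_apply (B := ℂ) f ((Polynomial.aeval (R := ℂ) s).restrictScalars ℝ) P
  simpa [Polynomial.coe_aeval_eq_eval] using this

/-- The restriction of `P` to the line `s ↦ z + s R u`. -/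
noncomputable def linePoly {m : ℕ} (P : MvPolynomial (Fin m) ℝ) (R : ℝ)
    (p : EuclideanSpace ℝ (Fin m) × EuclideanSpace ℝ (Fin m)) : ℂ[X] :=
  MvPolynomial.aeval (fun i => C (p.1 i : ℂ) + C ((R * p.2 i : ℝ) : ℂ) * X) P

lemma eval_linePoly {m : ℕ} (P : MvPolynomial (Fin m) ℝ) (R : ℝ)
    (p : EuclideanSpace ℝ (Fin m) × EuclideanSpace ℝ (Fin m)) (s : ℂ) :
    (linePoly P R p).eval s
      = MvPolynomial.aeval (fun i => (p.1 i : ℂ) + ((R * p.2 i : ℝ) : ℂ) * s) P := by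
  rw [linePoly, eval_aeval_mvPolynomial]; simp

lemma natDegree_linePoly_le {m k : ℕ} {P : MvPolynomial (Fin m) ℝ} (h : P.IsHomogeneous k) (R : ℝ)
    (p : EuclideanSpace ℝ (Fin m) × EuclideanSpace ℝ (Fin m)) :
    (linePoly P R p).natDegree ≤ k := by
  have h1 : linePoly P R p = MvPolynomial.aeval
      (fun i => C (p.1 i : ℂ) + C ((R * p.2 i : ℝ) : ℂ) * X)
      (MvPolynomial.map (algebraMap ℝ ℂ) P) := by
    rw [linePoly, MvPolynomial.aeval_map_algebraMap]
  rw [h1, ← mul_one k]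
  refine MvPolynomial.aeval_natDegree_le _ ?_ _ fun i => ?_
  · exact (h.map (algebraMap ℝ ℂ)).totalDegree_le
  · rw [add_comm]; exact natDegree_linear_le

lemma exists_linForm_factorization {m k : ℕ} {P : MvPolynomial (Fin m) ℝ} (h : P.IsHomogeneous k)
    (p : EuclideanSpace ℝ (Fin m) × EuclideanSpace ℝ (Fin m)) :
    ∃ (a : ℂ) (L : Multiset (ℂ × ℂ)), Multiset.card L = k ∧ ∀ R θ : ℝ, R ≠ 0 →
      linePoly P R (planeRot (cos θ) (sin θ) p) = C a * (L.map fun q => linForm R q θ).prod := by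
  set H := linePoly P 1 p with hH
  have hsp := IsAlgClosed.splits H
  refine ⟨H.leadingCoeff, Multiset.replicate (k - H.natDegree) ((1 : ℂ), (0 : ℂ))
    + H.roots.map fun r => (-r, (1 : ℂ)), ?_, fun R θ hR => ?_⟩
  · have : H.natDegree ≤ k := natDegree_linePoly_le h 1 p
    rw [Multiset.card_add, Multiset.card_replicate, Multiset.card_map, ← hsp.natDegree_eq_card_roots]
    omega
  · refine eq_of_infinite_eval_eq _ _ ?_
    have hfin : ({t : ℂ | (cos θ : ℂ) - t * R * sin θ = 0}).Finite := by
      refine Set.Subsingleton.finite ?_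
      intro t₁ h₁ t₂ h₂
      have h₁' : (cos θ : ℂ) - t₁ * R * sin θ = 0 := h₁
      have h₂' : (cos θ : ℂ) - t₂ * R * sin θ = 0 := h₂
      have h3 : (t₁ - t₂) * (R * sin θ : ℂ) = 0 := by linear_combination h₂' - h₁'
      rcases mul_eq_zero.1 h3 with h4 | h4
      · exact sub_eq_zero.1 h4
      · exfalso
        have hs : sin θ = 0 := by
          rcases mul_eq_zero.1 h4 with h5 | h5
          · exact absurd (by exact_mod_cast h5) hR
          · exact_mod_cast h5
        have hc : cos θ = 0 := by
          rw [hs, Complex.ofReal_zero] at h₁'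
          have h₂ : ((cos θ : ℝ) : ℂ) = 0 := by linear_combination h₁'
          exact_mod_cast h₂
        have := sin_sq_add_cos_sq θ
        rw [hs, hc] at this
        norm_num at this
    refine hfin.infinite_compl.mono fun t ht => ?_
    have hx : (cos θ : ℂ) - t * R * sin θ ≠ 0 := ht
    set x : ℂ := (cos θ : ℂ) - t * R * sin θ with hxd
    set y : ℂ := (sin θ : ℂ) + t * R * cos θ with hyd
    have e1 : (linePoly P R (planeRot (cos θ) (sin θ) p)).eval t = x ^ k * H.eval (y / x) := by
      rw [hH, eval_linePoly, eval_linePoly, ← h.aeval_smul']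
      congr 2
      funext i
      simp only [planeRot, PiLp.add_apply, PiLp.smul_apply, smul_eq_mul]
      simp only [Complex.ofReal_mul, Complex.ofReal_add, Complex.ofReal_neg, Complex.ofReal_one]
      field_simp
      rw [hxd, hyd]
      ring
    have e2 : ∀ q : ℂ × ℂ, (linForm R q θ).eval t = q.1 * x + q.2 * y := by
      intro q; simp [linForm, hxd, hyd]; ring
    change _ = _
    rw [e1, hsp.eval_eq_prod_roots, eval_mul, eval_C, eval_multiset_prod, Multiset.map_map]
    simp only [Function.comp_def, e2, Multiset.map_add, Multiset.map_replicate, Multiset.map_map,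
      Multiset.prod_add, Multiset.prod_replicate]
    have hdeg : H.natDegree ≤ k := natDegree_linePoly_le h 1 p
    have e3 : (H.roots.map fun r => -r * x + 1 * y).prod
        = x ^ H.natDegree * (H.roots.map fun r => y / x - r).prod := by
      rw [hsp.natDegree_eq_card_roots, ← Multiset.prod_replicate, ← Multiset.map_const',
        ← Multiset.prod_map_mul]
      congr 1
      refine Multiset.map_congr rfl fun r _ => ?_
      field_simp
      ring
    rw [e3]
    nth_rewrite 1 [show k = (k - H.natDegree) + H.natDegree by omega]
    rw [pow_add]
    simp
    ring

lemma lintegral_mahlerExcess_rot {m k : ℕ} {P : MvPolynomial (Fin m) ℝ} (h : P.IsHomogeneous k)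
    {R : ℝ} (hR : 0 < R) (hR1 : R ≤ 1)
    (p : EuclideanSpace ℝ (Fin m) × EuclideanSpace ℝ (Fin m)) :
    ∫⁻ θ, mahlerExcess (linePoly P R (planeRot (cos θ) (sin θ) p)) ∂angleMeasure
      ≤ ENNReal.ofReal (k * (2 * R / Real.pi)) := by
  obtain ⟨a, L, hL, hf⟩ := exists_linForm_factorization h p
  simp only [hf _ _ hR.ne']
  refine (lintegral_mono fun θ => mahlerExcess_mul_le _ _).trans ?_
  simp only [mahlerExcess_C, zero_add]
  refine (lintegral_mahlerExcess_prod_linForm hR hR1 L).trans_eq ?_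
  rw [hL, ENNReal.ofReal_mul (by positivity), ENNReal.ofReal_natCast]

end MahlerExcess

section ExcessIntegral

lemma eval_zero_linePoly {m : ℕ} (P : MvPolynomial (Fin m) ℝ) (R : ℝ)
    (p : EuclideanSpace ℝ (Fin m) × EuclideanSpace ℝ (Fin m)) :
    (linePoly P R p).eval 0 = ((MvPolynomial.eval (fun i => p.1 i) P : ℝ) : ℂ) := by
  rw [eval_linePoly]
  simp only [mul_zero, add_zero]
  have := MvPolynomial.aeval_algebraMap_apply (R := ℝ) (A := ℝ) ℂ (fun i => p.1 i) P
  simpa [MvPolynomial.coe_aeval_eq_eval, Function.comp_def] using this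

lemma continuous_aeval_mvPolynomial {m : ℕ} (P : MvPolynomial (Fin m) ℝ) :
    Continuous fun x : Fin m → ℂ => MvPolynomial.aeval x P := by
  simp only [MvPolynomial.aeval_def, MvPolynomial.eval₂_eq]
  fun_prop

lemma measurable_mahlerExcess_linePoly {m : ℕ} (P : MvPolynomial (Fin m) ℝ) (R : ℝ) :
    Measurable fun p : EuclideanSpace ℝ (Fin m) × EuclideanSpace ℝ (Fin m) =>
      mahlerExcess (linePoly P R p) := by
  unfold mahlerExcess
  have h0 : Measurable fun p : EuclideanSpace ℝ (Fin m) × EuclideanSpace ℝ (Fin m) =>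
      (linePoly P R p).eval 0 := by
    simp only [eval_linePoly]
    refine ((continuous_aeval_mvPolynomial P).comp ?_).measurable
    fun_prop
  refine Measurable.ite (h0 (measurableSet_singleton 0)) measurable_const ?_
  refine ENNReal.measurable_ofReal.comp (Measurable.sub ?_ (Real.measurable_log.comp h0.norm))
  simp only [Polynomial.logMahlerMeasure_def, Real.circleAverage_def, smul_eq_mul]
  refine Measurable.const_mul ?_ _
  simp only [intervalIntegral.integral_of_le (show (0 : ℝ) ≤ 2 * Real.pi by positivity)]
  have hm : StronglyMeasurable fun q : (EuclideanSpace ℝ (Fin m) × EuclideanSpace ℝ (Fin m)) × ℝ =>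
      Real.log ‖(linePoly P R q.1).eval (circleMap 0 1 q.2)‖ := by
    refine (Real.measurable_log.comp (Measurable.norm ?_)).stronglyMeasurable
    simp only [eval_linePoly]
    refine ((continuous_aeval_mvPolynomial P).comp ?_).measurable
    fun_prop
  exact hm.integral_prod_right.measurable

variable {n : ℕ}

local notation "𝔼" => EuclideanSpace ℝ (Fin (n + 1))

lemma measurable_planeRot_angle : Measurable fun q : ℝ × (𝔼 × 𝔼) =>
    planeRot (Real.cos q.1) (Real.sin q.1) q.2 := by
  unfold planeRot
  fun_prop

lemma lintegral_doubleCone_excess_le (hn : 1 ≤ n) {a : 𝔼} (ha : ‖a‖ = 1) {σ : ℝ} (hσ : 0 < σ)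
    (hσ1 : σ ≤ 1) {P : MvPolynomial (Fin (n + 1)) ℝ} {k : ℕ} (h : P.IsHomogeneous k) {R : ℝ}
    (hR : 0 < R) (hR1 : R ≤ 1) :
    ∫⁻ z in doubleCone a σ, ∫⁻ u, mahlerExcess (linePoly P R (z, u)) ∂stdGaussian 𝔼 ∂stdGaussian 𝔼
      ≤ ENNReal.ofReal σ ^ (n - 1) * ENNReal.ofReal (k * (2 * R / Real.pi)) := by
  have hK := (isOpen_doubleCone a σ).measurableSet
  have hmF := measurable_mahlerExcess_linePoly P R
  set G : 𝔼 × 𝔼 → ℝ≥0∞ := (Prod.fst ⁻¹' doubleCone a σ).indicator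
    (fun p => mahlerExcess (linePoly P R p)) with hG
  have hGm : Measurable G := hmF.indicator (measurable_fst hK)
  have h1 : ∫⁻ z in doubleCone a σ, ∫⁻ u, mahlerExcess (linePoly P R (z, u)) ∂stdGaussian 𝔼
      ∂stdGaussian 𝔼 = ∫⁻ p, G p ∂((stdGaussian 𝔼).prod (stdGaussian 𝔼)) := by
    rw [lintegral_prod _ hGm.aemeasurable, ← lintegral_indicator hK]
    refine lintegral_congr fun z => ?_
    by_cases hz : z ∈ doubleCone a σ
    · rw [Set.indicator_of_mem hz]
      refine lintegral_congr fun u => ?_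
      rw [hG, Set.indicator_of_mem (by exact hz)]
    · rw [Set.indicator_of_notMem hz]
      have : ∀ u, G (z, u) = 0 := fun u =>
        Set.indicator_of_notMem (s := Prod.fst ⁻¹' doubleCone a σ) (by exact hz) _
      simp [this]
  have hm2 : Measurable fun q : ℝ × (𝔼 × 𝔼) => G (planeRot (Real.cos q.1) (Real.sin q.1) q.2) :=
    hGm.comp measurable_planeRot_angle
  rw [h1]
  calc ∫⁻ p, G p ∂((stdGaussian 𝔼).prod (stdGaussian 𝔼))
      = ∫⁻ θ, ∫⁻ p, G (planeRot (Real.cos θ) (Real.sin θ) p)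
          ∂((stdGaussian 𝔼).prod (stdGaussian 𝔼)) ∂angleMeasure := by
        simp_rw [stdGaussian_prod_rot (Real.cos_sq_add_sin_sq _) hGm]
        simp
    _ = ∫⁻ p, ∫⁻ θ, G (planeRot (Real.cos θ) (Real.sin θ) p) ∂angleMeasure
          ∂((stdGaussian 𝔼).prod (stdGaussian 𝔼)) := by
        rw [lintegral_lintegral_swap]
        exact hm2.aemeasurable
    _ ≤ ∫⁻ p in hitSet a σ, ENNReal.ofReal (k * (2 * R / Real.pi))
          ∂((stdGaussian 𝔼).prod (stdGaussian 𝔼)) := by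
        rw [← lintegral_indicator (isOpen_hitSet a σ).measurableSet]
        refine lintegral_mono fun p => ?_
        by_cases hp : p ∈ hitSet a σ
        · rw [Set.indicator_of_mem hp]
          refine (lintegral_mono fun θ => ?_).trans (lintegral_mahlerExcess_rot h hR hR1 p)
          exact Set.indicator_le_self _ _ _
        · rw [Set.indicator_of_notMem hp, nonpos_iff_eq_zero]
          have : ∀ θ : ℝ, G (planeRot (Real.cos θ) (Real.sin θ) p) = 0 := fun θ =>
            Set.indicator_of_notMem (s := Prod.fst ⁻¹' doubleCone a σ)
              (fun hm => hp ⟨_, _, Real.cos_sq_add_sin_sq θ, hm⟩) _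
          simp [this]
    _ ≤ _ := by
        rw [setLIntegral_const, mul_comm]
        gcongr
        exact measure_hitSet_le hn ha hσ hσ1

end ExcessIntegral

section LowerBound

open scoped ComplexConjugate

open Polynomial
open Real (posLog)

variable {m : ℕ}

/-- The polynomial `P` on the complexified affine plane `z + a e + b v`. -/
noncomputable def planeEval (P : MvPolynomial (Fin m) ℝ) (z e v : EuclideanSpace ℝ (Fin m))
    (a b : ℂ) : ℂ :=
  MvPolynomial.aeval (fun i => (z i : ℂ) + a * e i + b * v i) P

lemma continuous_planeEval (P : MvPolynomial (Fin m) ℝ) (z e v : EuclideanSpace ℝ (Fin m)) :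
    Continuous fun q : ℂ × ℂ => planeEval P z e v q.1 q.2 := by
  unfold planeEval
  exact (continuous_aeval_mvPolynomial P).comp (by fun_prop)

lemma exists_planeEval_eq_eval (P : MvPolynomial (Fin m) ℝ) (z e v : EuclideanSpace ℝ (Fin m))
    (f g : ℂ[X]) : ∃ p : ℂ[X], ∀ s, p.eval s = planeEval P z e v (f.eval s) (g.eval s) := by
  refine ⟨MvPolynomial.aeval (fun i => C (z i : ℂ) + f * C (e i : ℂ) + g * C (v i : ℂ)) P,
    fun s => ?_⟩
  rw [eval_aeval_mvPolynomial]; simp [planeEval]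

lemma exists_norm_planeEval_le (P : MvPolynomial (Fin m) ℝ) (z e v : EuclideanSpace ℝ (Fin m))
    (r : ℝ) : ∃ M : ℝ, ∀ a b : ℂ, ‖a‖ ≤ r → ‖b‖ ≤ r → ‖planeEval P z e v a b‖ ≤ Real.exp M := by
  have hc : IsCompact (Metric.closedBall (0 : ℂ) r ×ˢ Metric.closedBall (0 : ℂ) r) :=
    (isCompact_closedBall _ _).prod (isCompact_closedBall _ _)
  obtain ⟨B, hB⟩ := hc.exists_bound_of_continuousOn (continuous_planeEval P z e v).continuousOn
  refine ⟨B, fun a b ha hb => (hB (a, b) ⟨by simpa using ha, by simpa using hb⟩).trans ?_⟩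
  linarith [Real.add_one_le_exp B]

lemma eval_linePoly_eq_planeEval (P : MvPolynomial (Fin m) ℝ) (R : ℝ)
    (z e v : EuclideanSpace ℝ (Fin m)) (g : ℝ) (s : ℂ) :
    (linePoly P R (z, g • e + v)).eval s = planeEval P z e v (R * s * g) (R * s) := by
  rw [eval_linePoly, planeEval]
  congr 2
  funext i
  simp only [PiLp.add_apply, PiLp.smul_apply, smul_eq_mul, Complex.ofReal_mul, Complex.ofReal_add]
  ring

lemma posLog_le_avg_mahlerExcess {P : MvPolynomial (Fin m) ℝ}
    {R : ℝ} (hR : 0 < R) {z e v : EuclideanSpace ℝ (Fin m)}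
    {η : ℝ} (hη : 0 < η) (hz : MvPolynomial.eval (fun i => z i) P ≠ 0)
    (hze : MvPolynomial.eval (fun i => (z + η • e) i) P = 0) (g h : ℝ) :
    ENNReal.ofReal (posLog (R * √(g ^ 2 + h ^ 2) / (2 * η)))
      ≤ ∫⁻ τ, mahlerExcess (linePoly P R (z, (g * Real.cos τ + h * Real.sin τ) • e + v))
          ∂angleMeasure := by
  set ξ : ℂ := ⟨g, -h⟩ with hξ
  have hnξ : ‖ξ‖ = √(g ^ 2 + h ^ 2) := by
    rw [Complex.norm_def, Complex.normSq_apply]; congr 1; simp [hξ]; ring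
  rw [← hnξ]
  rcases eq_or_ne ξ 0 with h0 | hξ0
  · simp [h0]
  obtain ⟨M, hM⟩ := exists_norm_planeEval_le P z e v (max (R * ‖ξ‖) R)
  set Q := planeEval P z e v with hQ
  set w : ℝ → ℂ := circleMap 0 1 with hw
  have hwn : ∀ θ, ‖w θ‖ = 1 := fun θ => by simp [hw]
  have hwadd : ∀ θ τ, w (θ + τ) = w θ * w τ := fun θ τ => by
    simp [hw, circleMap, add_mul, Complex.exp_add]
  have hwper : Function.Periodic w (2 * Real.pi) := periodic_circleMap 0 1
  have hwc : Continuous w := continuous_circleMap 0 1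
  set γ : ℝ → ℝ := fun τ => g * Real.cos τ + h * Real.sin τ with hγ
  have hγw : ∀ τ, (γ τ : ℂ) * w τ = (ξ * w τ ^ 2 + conj ξ) / 2 := by
    intro τ
    have hwe : w τ = ⟨Real.cos τ, Real.sin τ⟩ := by
      rw [hw, circleMap, zero_add, Complex.ofReal_one, one_mul, Complex.exp_mul_I]
      apply Complex.ext <;> simp [Complex.cos_ofReal_re, Complex.sin_ofReal_re]
    have hsc := Real.sin_sq_add_cos_sq τ
    rw [eq_div_iff two_ne_zero, hwe]
    apply Complex.ext
    · simp [hγ, hξ, pow_two, Complex.cos_ofReal_re, Complex.sin_ofReal_re]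
      linear_combination g * hsc
    · simp [hγ, hξ, pow_two, Complex.cos_ofReal_re, Complex.sin_ofReal_re]
      linear_combination h * hsc
  have hγn : ∀ τ, |γ τ| ≤ ‖ξ‖ := by
    intro τ
    rw [hnξ]
    refine Real.abs_le_sqrt ?_
    nlinarith [Real.sin_sq_add_cos_sq τ, sq_nonneg (g * Real.sin τ - h * Real.cos τ)]
  have hcM : Measurable (logGap M) := measurable_logGap M
  have hQc : Continuous fun q : ℂ × ℂ => Q q.1 q.2 := continuous_planeEval P z e v
  have hQ0 : Q 0 0 = ((MvPolynomial.eval (fun i => z i) P : ℝ) : ℂ) := by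
    rw [← eval_zero_linePoly P R (z, 0), eval_linePoly]; simp [hQ, planeEval]
  have hQ0' : Q 0 0 ≠ 0 := by rw [hQ0]; exact_mod_cast hz
  have hQη : Q η 0 = 0 := by
    have := eval_zero_linePoly P R (z + η • e, 0)
    rw [hze, eval_linePoly] at this
    simpa [hQ, planeEval] using this
  set D := logGap M ‖Q 0 0‖ with hD
  have hDfin : D ≠ ⊤ := by simp [hD, logGap, hQ0']
  have hline : ∀ τ, D ≤ (∫⁻ θ, logGap M ‖Q (R * w θ * γ τ) (R * w θ)‖ ∂angleMeasure)
      + mahlerExcess (linePoly P R (z, γ τ • e + v)) := by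
    intro τ
    set p := linePoly P R (z, γ τ • e + v) with hp
    have hpe : ∀ s, p.eval s = Q (R * s * γ τ) (R * s) := eval_linePoly_eq_planeEval P R z e v _
    have hp0 : p.eval 0 = Q 0 0 := by rw [hpe]; simp
    have hpne : p ≠ 0 := by intro h; rw [h, eval_zero] at hp0; exact hQ0' hp0.symm
    have hb : ∀ θ : ℝ, ‖p.eval (w θ)‖ ≤ Real.exp M := by
      intro θ
      rw [hpe]
      refine hM _ _ (le_max_of_le_left ?_) (le_max_of_le_right ?_)
      · rw [norm_mul, norm_mul, hwn, Complex.norm_real, Complex.norm_real, Real.norm_of_nonneg hR.le,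
          mul_one, Real.norm_eq_abs]
        exact mul_le_mul_of_nonneg_left (hγn τ) hR.le
      · rw [norm_mul, hwn, Complex.norm_real, Real.norm_of_nonneg hR.le, mul_one]
    simp_rw [← hpe]
    rw [lintegral_logGap_eval hpne hb, hD, ← hp0]
    simp only [logGap, norm_eq_zero, mahlerExcess, hp0, hQ0', if_false]
    rw [← hp0]
    refine le_trans (ENNReal.ofReal_le_ofReal ?_) ENNReal.ofReal_add_le
    linarith
  have hΦ : Measurable fun τ => mahlerExcess (linePoly P R (z, γ τ • e + v)) := by
    refine (measurable_mahlerExcess_linePoly P R).comp ?_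
    simp only [hγ]
    fun_prop
  have hX1 : D ≤ (∫⁻ τ, ∫⁻ θ, logGap M ‖Q (R * w θ * γ τ) (R * w θ)‖ ∂angleMeasure ∂angleMeasure)
      + ∫⁻ τ, mahlerExcess (linePoly P R (z, γ τ • e + v)) ∂angleMeasure := by
    rw [← lintegral_add_right _ hΦ]
    calc D = ∫⁻ τ, D ∂angleMeasure := by simp
      _ ≤ _ := lintegral_mono hline
  set Y := ∫⁻ τ, mahlerExcess (linePoly P R (z, γ τ • e + v)) ∂angleMeasure
  set W := ∫⁻ τ, ∫⁻ θ, logGap M ‖Q (R * w θ * γ τ) (R * w θ)‖ ∂angleMeasure ∂angleMeasure with hW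
  have hX2 : W = ∫⁻ θ, ∫⁻ τ, logGap M ‖Q (R * w θ * ((ξ * w τ ^ 2 + conj ξ) / 2))
      (R * w θ * w τ)‖ ∂angleMeasure ∂angleMeasure := by
    rw [lintegral_lintegral_swap]
    · refine lintegral_congr fun τ => ?_
      rw [← lintegral_angleMeasure_add _ τ]
      · refine lintegral_congr fun θ => ?_
        rw [hwadd, ← hγw]
        congr 3 <;> ring
      · intro θ
        simp only [hwper θ]
    · refine (hcM.comp (Continuous.measurable ?_)).aemeasurable
      refine (hQc.comp (g := fun q : ℂ × ℂ => Q q.1 q.2) (f := fun x : ℝ × ℝ =>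
        (R * w x.1 * ((ξ * w x.2 ^ 2 + conj ξ) / 2), R * w x.1 * w x.2)) ?_).norm
      fun_prop
  have hX3 : ∀ θ, ∫⁻ τ, logGap M ‖Q (R * w θ * ((ξ * w τ ^ 2 + conj ξ) / 2))
      (R * w θ * w τ)‖ ∂angleMeasure ≤ logGap M ‖Q (R * w θ * (conj ξ / 2)) 0‖ := by
    intro θ
    obtain ⟨p, hp⟩ := exists_planeEval_eq_eval P z e v
      (C (R * w θ : ℂ) * ((C ξ * X ^ 2 + C (conj ξ)) * C (1 / 2))) (C (R * w θ : ℂ) * X)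
    have hp' : ∀ s, p.eval s = Q (R * w θ * ((ξ * s ^ 2 + conj ξ) / 2)) (R * w θ * s) := by
      intro s; rw [hp]; simp only [eval_mul, eval_C, eval_add, eval_pow, eval_X]
      congr 1; ring
    have hb : ∀ τ : ℝ, ‖p.eval (w τ)‖ ≤ Real.exp M := by
      intro τ
      rw [hp']
      refine hM _ _ (le_max_of_le_left ?_) (le_max_of_le_right ?_)
      · rw [← hγw, norm_mul, norm_mul, norm_mul, hwn, hwn, Complex.norm_real, Complex.norm_real,
          Real.norm_of_nonneg hR.le, mul_one, mul_one, Real.norm_eq_abs]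
        exact mul_le_mul_of_nonneg_left (hγn τ) hR.le
      · rw [norm_mul, norm_mul, hwn, hwn, Complex.norm_real, Real.norm_of_nonneg hR.le, mul_one,
          mul_one]
    have := lintegral_logGap_eval_le p hb
    simp only [hp'] at this
    simpa using this
  have hX4 : (∫⁻ θ, logGap M ‖Q (R * w θ * (conj ξ / 2)) 0‖ ∂angleMeasure)
      + ENNReal.ofReal (posLog (R * ‖ξ‖ / (2 * η))) ≤ D := by
    obtain ⟨p, hp⟩ := exists_planeEval_eq_eval P z e v (C (R * (conj ξ / 2) : ℂ) * X) 0
    have hp' : ∀ s, p.eval s = Q (R * s * (conj ξ / 2)) 0 := by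
      intro s; rw [hp]; simp only [eval_mul, eval_C, eval_X, eval_zero]
      congr 1; ring
    have hRc : (R : ℂ) ≠ 0 := by exact_mod_cast hR.ne'
    have hξc : conj ξ ≠ 0 := by simpa using hξ0
    have hζ : p.eval (2 * η / (R * conj ξ)) = 0 := by
      rw [hp', ← hQη]; congr 1; field_simp
    have hb : ∀ θ : ℝ, ‖p.eval (w θ)‖ ≤ Real.exp M := by
      intro θ
      rw [hp']
      refine hM _ _ (le_max_of_le_left ?_) (le_max_of_le_right (by simpa using hR.le))
      rw [norm_mul, norm_mul, hwn, Complex.norm_real, Real.norm_of_nonneg hR.le, mul_one, norm_div,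
        Complex.norm_conj]
      simp only [Complex.norm_ofNat]
      have := norm_nonneg ξ
      exact mul_le_mul_of_nonneg_left (by linarith) hR.le
    have := lintegral_logGap_eval_add_le p hζ hb
    have hn : ‖(2 * η / (R * conj ξ) : ℂ)‖⁻¹ = R * ‖ξ‖ / (2 * η) := by
      rw [norm_div, norm_mul, norm_mul, Complex.norm_conj, Complex.norm_real, Complex.norm_real,
        Real.norm_of_nonneg hR.le, Real.norm_of_nonneg hη.le, Complex.norm_ofNat, inv_div]
    rw [hn] at this
    simp only [hp'] at this
    simpa [hD] using this
  have hX5 : W ≤ ∫⁻ θ, logGap M ‖Q (R * w θ * (conj ξ / 2)) 0‖ ∂angleMeasure := by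
    rw [hX2]; exact lintegral_mono hX3
  have hX6 : W + ENNReal.ofReal (posLog (R * ‖ξ‖ / (2 * η))) ≤ W + Y :=
    ((add_le_add_left hX5 _).trans hX4).trans hX1
  have hXfin : W ≠ ⊤ := ne_top_of_le_ne_top hDfin ((hX5.trans le_self_add).trans hX4)
  exact (ENNReal.add_le_add_iff_left hXfin).1 hX6

end LowerBound

section TubeBound

open Real (posLog)
open scoped Pointwise

variable {n : ℕ}

local notation "𝔼" => EuclideanSpace ℝ (Fin (n + 1))

lemma two_le_posLog_add {x : ℝ} (hx : 0 < x) : 2 ≤ posLog x + Real.exp 1 * x⁻¹ := by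
  have he := Real.exp_pos 1
  have h := Real.one_sub_inv_le_log_of_pos (x := x / Real.exp 1) (by positivity)
  rw [Real.log_div hx.ne' he.ne', Real.log_exp, inv_div] at h
  have h2 : Real.log x ≤ posLog x := le_max_right _ _
  rw [div_eq_mul_inv] at h
  linarith

lemma lintegral_posLog_le_mahlerExcess {P : MvPolynomial (Fin (n + 1)) ℝ} {R : ℝ} (hR : 0 < R)
    {z e : 𝔼} (he : ‖e‖ = 1) {η : ℝ} (hη : 0 < η)
    (hz : MvPolynomial.eval (fun i => z i) P ≠ 0)
    (hze : MvPolynomial.eval (fun i => (z + η • e) i) P = 0) :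
    ∫⁻ g, ∫⁻ h, ENNReal.ofReal (posLog (R * √(g ^ 2 + h ^ 2) / (2 * η)))
        ∂(gaussianReal 0 1) ∂(gaussianReal 0 1)
      ≤ ∫⁻ u, mahlerExcess (linePoly P R (z, u)) ∂stdGaussian 𝔼 := by
  have hm : Measurable fun u => mahlerExcess (linePoly P R (z, u)) :=
    (measurable_mahlerExcess_linePoly P R).comp measurable_prodMk_left
  rw [lintegral_gaussian_split he hm]
  set I := ∫⁻ g, ∫⁻ h, ENNReal.ofReal (posLog (R * √(g ^ 2 + h ^ 2) / (2 * η)))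
        ∂(gaussianReal 0 1) ∂(gaussianReal 0 1) with hI
  have hp : Measurable posLog := by unfold Real.posLog; fun_prop
  suffices h : ∀ v : 𝔼, I ≤ ∫⁻ g, mahlerExcess (linePoly P R (z, g • e + v)) ∂gaussianReal 0 1 by
    calc I = ∫⁻ v : 𝔼, I ∂stdGaussian 𝔼 := by simp
      _ ≤ _ := lintegral_mono fun v => h (v - ⟪v, e⟫ • e)
  intro v
  set Φ : ℝ → ℝ≥0∞ := fun g => mahlerExcess (linePoly P R (z, g • e + v)) with hΦ
  have hΦm : Measurable Φ := hm.comp (f := fun g : ℝ => g • e + v) (by fun_prop)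
  set G := (gaussianReal 0 1).prod (gaussianReal 0 1)
  have hΦ2 : Measurable fun p : ℝ × ℝ => Φ p.1 := hΦm.comp measurable_fst
  have hmI : Measurable fun p : ℝ × ℝ =>
      ENNReal.ofReal (posLog (R * √(p.1 ^ 2 + p.2 ^ 2) / (2 * η))) :=
    ENNReal.measurable_ofReal.comp (hp.comp (by fun_prop))
  calc I = ∫⁻ p : ℝ × ℝ, ENNReal.ofReal (posLog (R * √(p.1 ^ 2 + p.2 ^ 2) / (2 * η))) ∂G := by
        rw [lintegral_prod _ hmI.aemeasurable]
    _ ≤ ∫⁻ p : ℝ × ℝ, ∫⁻ τ, Φ (p.1 * Real.cos τ + p.2 * Real.sin τ) ∂angleMeasure ∂G :=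
        lintegral_mono fun p => posLog_le_avg_mahlerExcess hR hη hz hze p.1 p.2
    _ = ∫⁻ τ, ∫⁻ p : ℝ × ℝ, Φ (p.1 * Real.cos τ + p.2 * Real.sin τ) ∂G ∂angleMeasure := by
        rw [lintegral_lintegral_swap]
        exact (hΦm.comp (f := fun q : (ℝ × ℝ) × ℝ =>
          q.1.1 * Real.cos q.2 + q.1.2 * Real.sin q.2) (by fun_prop)).aemeasurable
    _ = ∫⁻ τ, ∫⁻ p : ℝ × ℝ, Φ p.1 ∂G ∂angleMeasure := by
        refine lintegral_congr fun τ => ?_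
        rw [← lintegral_planeRot_of_charFun charFun_gaussianReal_std
          (Real.cos_sq_add_sin_sq τ) hΦ2]
        refine lintegral_congr fun p => ?_
        simp only [planeRot, smul_eq_mul]
        congr 1; ring
    _ = ∫⁻ g, Φ g ∂gaussianReal 0 1 := by
        rw [lintegral_prod _ hΦ2.aemeasurable]
        simp

lemma two_le_lintegral_mahlerExcess_add {P : MvPolynomial (Fin (n + 1)) ℝ} {R : ℝ} (hR : 0 < R)
    {z e : 𝔼} (he : ‖e‖ = 1) {η : ℝ} (hη : 0 < η)
    (hz : MvPolynomial.eval (fun i => z i) P ≠ 0)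
    (hze : MvPolynomial.eval (fun i => (z + η • e) i) P = 0) :
    2 ≤ (∫⁻ u, mahlerExcess (linePoly P R (z, u)) ∂stdGaussian 𝔼)
      + ENNReal.ofReal (2 * Real.exp 1 * η / R * √(Real.pi / 2)) := by
  have : NullSingletonClass (gaussianReal 0 1) := nullSingletonClass_gaussianReal one_ne_zero
  have h0 : ∀ᵐ g ∂gaussianReal 0 1, g ≠ 0 := by
    rw [ae_iff]; simp
  have he1 := Real.exp_pos 1
  set c := 2 * Real.exp 1 * η / R with hc
  have hc0 : 0 ≤ c := by positivity
  have hp : Measurable posLog := by unfold Real.posLog; fun_prop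
  have hm : ∀ g : ℝ, Measurable fun h : ℝ =>
      ENNReal.ofReal (posLog (R * √(g ^ 2 + h ^ 2) / (2 * η))) := fun g =>
    ENNReal.measurable_ofReal.comp (hp.comp (by fun_prop))
  have hm2 : Measurable fun g : ℝ => ∫⁻ h,
      ENNReal.ofReal (posLog (R * √(g ^ 2 + h ^ 2) / (2 * η))) ∂gaussianReal 0 1 := by
    refine Measurable.lintegral_prod_right' (f := fun p : ℝ × ℝ =>
      ENNReal.ofReal (posLog (R * √(p.1 ^ 2 + p.2 ^ 2) / (2 * η)))) ?_
    exact ENNReal.measurable_ofReal.comp (hp.comp (by fun_prop))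
  calc (2 : ℝ≥0∞) = ∫⁻ g, ∫⁻ h, 2 ∂(gaussianReal 0 1) ∂(gaussianReal 0 1) := by simp
    _ ≤ ∫⁻ g, ∫⁻ h, (ENNReal.ofReal (posLog (R * √(g ^ 2 + h ^ 2) / (2 * η)))
          + ENNReal.ofReal c * ENNReal.ofReal (√(g ^ 2 + h ^ 2))⁻¹)
          ∂(gaussianReal 0 1) ∂(gaussianReal 0 1) := by
        refine lintegral_mono_ae ?_
        filter_upwards [h0] with g hg
        refine lintegral_mono fun h => ?_
        have hr : 0 < √(g ^ 2 + h ^ 2) := Real.sqrt_pos.2 (by positivity)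
        rw [← ENNReal.ofReal_mul hc0, ← ENNReal.ofReal_add Real.posLog_nonneg (by positivity),
          show (2 : ℝ≥0∞) = ENNReal.ofReal 2 by simp]
        refine ENNReal.ofReal_le_ofReal ?_
        refine (two_le_posLog_add (x := R * √(g ^ 2 + h ^ 2) / (2 * η)) (by positivity)).trans_eq ?_
        congr 1
        rw [hc]; field_simp
    _ = (∫⁻ g, ∫⁻ h, ENNReal.ofReal (posLog (R * √(g ^ 2 + h ^ 2) / (2 * η)))
          ∂(gaussianReal 0 1) ∂(gaussianReal 0 1))
        + ENNReal.ofReal c * ENNReal.ofReal √(Real.pi / 2) := by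
        simp_rw [lintegral_add_left (hm _)]
        rw [lintegral_add_left hm2]
        simp_rw [lintegral_const_mul' _ _ ENNReal.ofReal_ne_top]
        rw [lintegral_inv_radius]
    _ ≤ _ := by
        rw [ENNReal.ofReal_mul hc0]
        gcongr
        exact lintegral_posLog_le_mahlerExcess hR he hη hz hze

lemma tube_constant_le {N : ℝ} (hN : 0 < N) {ε : ℝ} (hε : 0 < ε) :
    2 * Real.exp 1 * ε / (7 * ε * √N) * √(Real.pi / 2) * √N ≤ 1 := by
  have h1 := Real.exp_one_lt_d9
  have h2 : √(Real.pi / 2) ≤ 1.26 := by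
    rw [Real.sqrt_le_left (by norm_num)]
    linarith [Real.pi_lt_d2]
  have hs : 0 < √N := Real.sqrt_pos.2 hN
  have h3 : 2 * Real.exp 1 * ε / (7 * ε * √N) * √(Real.pi / 2) * √N
      = 2 * (Real.exp 1 * √(Real.pi / 2)) / 7 := by field_simp
  rw [h3]
  have h4 : Real.exp 1 * √(Real.pi / 2) ≤ 2.7182818286 * 1.26 :=
    mul_le_mul h1.le h2 (Real.sqrt_nonneg _) (by norm_num)
  linarith

lemma smul_mem_iff_of_cone {S : Set 𝔼} (hS : ∀ x ∈ S, ∀ lam : ℝ, lam • x ∈ S) {c : ℝ} (hc : c ≠ 0)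
    (x : 𝔼) : c • x ∈ S ↔ x ∈ S := by
  refine ⟨fun h => ?_, fun h => hS x h c⟩
  have := hS _ h c⁻¹
  rwa [smul_smul, inv_mul_cancel₀ hc, one_smul] at this

lemma infDist_smul_of_cone {S : Set 𝔼} (hS : ∀ x ∈ S, ∀ lam : ℝ, lam • x ∈ S) (c : ℝ) (hc : c ≠ 0)
    (z : 𝔼) : Metric.infDist (c • z) S = |c| * Metric.infDist z S := by
  have h : c • S = S := by
    ext x
    rw [Set.mem_smul_set_iff_inv_smul_mem₀ hc]
    exact smul_mem_iff_of_cone hS (inv_ne_zero hc) x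
  conv_lhs => rw [← h]
  rw [infDist_smul₀ hc, Real.norm_eq_abs]

set_option maxHeartbeats 1000000 in
lemma measure_doubleCone_inter_tube_le (hn : 1 ≤ n) {a : 𝔼} (ha : ‖a‖ = 1) {σ : ℝ} (hσ : 0 < σ)
    (hσ1 : σ ≤ 1) {P : MvPolynomial (Fin (n + 1)) ℝ} (hP : P ≠ 0) {k : ℕ} (h : P.IsHomogeneous k)
    {S : Set 𝔼} (hSne : S.Nonempty) (hScl : IsClosed S)
    (hS : ∀ x ∈ S, ∀ lam : ℝ, lam • x ∈ S)
    (hSP : ∀ x ∈ S, MvPolynomial.eval (fun i => x i) P = 0)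
    {ε : ℝ} (hε : 0 < ε) (hε1 : 7 * ε * √(n + 1) ≤ 1) :
    stdGaussian 𝔼 (doubleCone a σ ∩ {z | Metric.infDist z S ≤ ε * ‖z‖})
      ≤ ENNReal.ofReal σ ^ (n - 1)
        * ENNReal.ofReal (k * (2 * (7 * ε * √(n + 1)) / Real.pi)) := by
  have hae : ∀ᵐ z ∂stdGaussian 𝔼, MvPolynomial.eval (fun i => z i) P ≠ 0 :=
    measure_eq_zero_iff_ae_notMem.1 (stdGaussian_eval_eq_zero hP)
  set R := 7 * ε * √(n + 1) with hR
  have hN : (0 : ℝ) < n + 1 := by positivity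
  have hR0 : 0 < R := by positivity
  set B := doubleCone a σ ∩ {z | Metric.infDist z S ≤ ε * ‖z‖} with hB
  have hKm := (isOpen_doubleCone a σ).measurableSet
  have hBm : MeasurableSet B :=
    hKm.inter (measurableSet_le (Metric.continuous_infDist_pt S).measurable (by fun_prop))
  have hcone : ∀ z : 𝔼, z ≠ 0 → (radialProj z ∈ B ↔ z ∈ B) := by
    intro z hz
    have hz' : 0 < ‖z‖ := norm_pos_iff.2 hz
    have hi : (‖z‖⁻¹ : ℝ) ≠ 0 := by positivity
    rw [hB, Set.mem_inter_iff, Set.mem_inter_iff]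
    refine and_congr ?_ ?_
    · change (1 - σ ^ 2) * ‖‖z‖⁻¹ • z‖ ^ 2 < ⟪‖z‖⁻¹ • z, a⟫ ^ 2 ↔ (1 - σ ^ 2) * ‖z‖ ^ 2 < ⟪z, a⟫ ^ 2
      rw [norm_smul, real_inner_smul_left, mul_pow, mul_pow, norm_inv, norm_norm, mul_left_comm]
      exact mul_lt_mul_iff_right₀ (by positivity)
    · change Metric.infDist (‖z‖⁻¹ • z) S ≤ ε * ‖‖z‖⁻¹ • z‖ ↔ Metric.infDist z S ≤ ε * ‖z‖
      rw [infDist_smul_of_cone hS _ hi, norm_smul, Real.norm_eq_abs, mul_left_comm]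
      exact mul_le_mul_iff_right₀ (by positivity)
  have hnorm : ∫⁻ z in B, ENNReal.ofReal ‖z‖ ∂stdGaussian 𝔼
      = (∫⁻ z, ENNReal.ofReal ‖z‖ ∂stdGaussian 𝔼) * stdGaussian 𝔼 B :=
    lintegral_norm_cone (fun L => stdGaussian_map L) stdGaussian_singleton_zero
      (ne_top_of_le_ne_top ENNReal.ofReal_ne_top lintegral_norm_stdGaussian_le) hBm hcone
  set F : 𝔼 → ℝ≥0∞ := fun z => ∫⁻ u, mahlerExcess (linePoly P R (z, u)) ∂stdGaussian 𝔼 with hF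
  set c := 2 * Real.exp 1 * ε / R * √(Real.pi / 2) with hc
  have hc0 : 0 ≤ c := by have := Real.exp_pos 1; positivity
  have hpt : ∀ z ∈ B, MvPolynomial.eval (fun i => z i) P ≠ 0 →
      2 ≤ F z + ENNReal.ofReal c * ENNReal.ofReal ‖z‖ := by
    intro z hz hPz
    obtain ⟨y, hyS, hy⟩ := hScl.exists_infDist_eq_dist hSne z
    have hyz : y - z ≠ 0 := by
      intro h0
      rw [sub_eq_zero] at h0
      exact hPz (h0 ▸ hSP y hyS)
    have hη : 0 < ‖y - z‖ := norm_pos_iff.2 hyz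
    have h1 := two_le_lintegral_mahlerExcess_add (P := P) hR0 (z := z) (e := ‖y - z‖⁻¹ • (y - z))
      (by rw [norm_smul, norm_inv, norm_norm, inv_mul_cancel₀ hη.ne']) hη hPz (by
        rw [smul_smul, mul_inv_cancel₀ hη.ne', one_smul, add_sub_cancel]
        exact hSP y hyS)
    refine h1.trans ?_
    rw [← ENNReal.ofReal_mul hc0]
    refine add_le_add le_rfl (ENNReal.ofReal_le_ofReal ?_)
    have h2 : ‖y - z‖ ≤ ε * ‖z‖ := by
      rw [← dist_eq_norm, dist_comm, ← hy]; exact hz.2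
    calc 2 * Real.exp 1 * ‖y - z‖ / R * √(Real.pi / 2)
        ≤ 2 * Real.exp 1 * (ε * ‖z‖) / R * √(Real.pi / 2) := by gcongr
      _ = c * ‖z‖ := by rw [hc]; ring
  have hFm : Measurable F := (measurable_mahlerExcess_linePoly P R).lintegral_prod_right'
  have hintegr : 2 * stdGaussian 𝔼 B ≤ (∫⁻ z in B, F z ∂stdGaussian 𝔼) + stdGaussian 𝔼 B := by
    calc 2 * stdGaussian 𝔼 B = ∫⁻ z in B, 2 ∂stdGaussian 𝔼 := by rw [setLIntegral_const]
      _ ≤ ∫⁻ z in B, (F z + ENNReal.ofReal c * ENNReal.ofReal ‖z‖) ∂stdGaussian 𝔼 := by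
          refine lintegral_mono_ae ?_
          filter_upwards [ae_restrict_of_ae hae, ae_restrict_mem hBm] with z h1 h2
          exact hpt z h2 h1
      _ = (∫⁻ z in B, F z ∂stdGaussian 𝔼)
          + ENNReal.ofReal c * ∫⁻ z in B, ENNReal.ofReal ‖z‖ ∂stdGaussian 𝔼 := by
          rw [lintegral_add_left hFm, lintegral_const_mul' _ _ ENNReal.ofReal_ne_top]
      _ ≤ _ := by
          gcongr
          rw [hnorm, ← mul_assoc]
          refine mul_le_of_le_one_left zero_le ?_
          refine (mul_le_mul_right lintegral_norm_stdGaussian_le _).trans ?_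
          rw [← ENNReal.ofReal_mul hc0, ← ENNReal.ofReal_one]
          exact ENNReal.ofReal_le_ofReal (tube_constant_le hN hε)
  have hfin : stdGaussian 𝔼 B ≠ ⊤ := measure_ne_top _ _
  rw [two_mul] at hintegr
  have h3 : stdGaussian 𝔼 B ≤ ∫⁻ z in B, F z ∂stdGaussian 𝔼 :=
    (ENNReal.add_le_add_iff_right hfin).1 hintegr
  refine h3.trans ((lintegral_mono_set Set.inter_subset_left).trans ?_)
  exact lintegral_doubleCone_excess_le hn ha hσ hσ1 h hR0 hε1

end TubeBound

section Assembly

variable {n : ℕ}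

local notation "𝔼" => EuclideanSpace ℝ (Fin (n + 1))

lemma stdGaussian_doubleCone_inter {a : 𝔼} {σ : ℝ} (hσ : 0 < σ) (hσ1 : σ ≤ 1) {T : Set 𝔼}
    (hT : MeasurableSet T) (hneg : ∀ z, -z ∈ T ↔ z ∈ T) :
    stdGaussian 𝔼 (doubleCone a σ ∩ T)
      = 2 * stdGaussian 𝔼 (doubleCone a σ ∩ T ∩ {z | 0 < ⟪z, a⟫}) := by
  have hK := (isOpen_doubleCone a σ).measurableSet
  have hH : MeasurableSet {z : 𝔼 | 0 < ⟪z, a⟫} :=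
    (isOpen_lt continuous_const (by fun_prop)).measurableSet
  have hset : (doubleCone a σ ∩ T) \ {z | 0 < ⟪z, a⟫}
      = LinearIsometryEquiv.neg ℝ ⁻¹' (doubleCone a σ ∩ T ∩ {z | 0 < ⟪z, a⟫}) := by
    ext z
    simp only [Set.mem_sdiff, Set.mem_inter_iff, Set.mem_preimage, LinearIsometryEquiv.coe_neg,
      mem_doubleCone, Set.mem_ofPred_eq, inner_neg_left, norm_neg, neg_sq, hneg, not_lt,
      Left.neg_pos_iff]
    refine and_congr_right fun h => ⟨fun h' => lt_of_le_of_ne h' fun h0 => ?_, le_of_lt⟩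
    have h1 : (1 - σ ^ 2) * ‖z‖ ^ 2 < ⟪z, a⟫ ^ 2 := h.1
    have h2 : 0 ≤ (1 - σ ^ 2) * ‖z‖ ^ 2 := by
      have : 0 ≤ 1 - σ ^ 2 := by nlinarith
      positivity
    rw [h0] at h1
    linarith
  have hm : stdGaussian 𝔼 (LinearIsometryEquiv.neg ℝ ⁻¹'
      (doubleCone a σ ∩ T ∩ {z | 0 < ⟪z, a⟫}))
      = stdGaussian 𝔼 (doubleCone a σ ∩ T ∩ {z | 0 < ⟪z, a⟫}) := by
    rw [← Measure.map_apply (by fun_prop) ((hK.inter hT).inter hH),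
      stdGaussian_map (LinearIsometryEquiv.neg ℝ : 𝔼 ≃ₗᵢ[ℝ] 𝔼)]
  rw [← measure_inter_add_sdiff _ hH, hset, hm, two_mul]

lemma radialProj_mem_cap {a : 𝔼} {σ : ℝ} (hσ : 0 < σ) (hσ1 : σ ≤ 1) (z : 𝔼) :
    radialProj z ∈ cap n a σ ↔ z ∈ doubleCone a σ ∧ 0 < ⟪z, a⟫ := by
  rcases eq_or_ne z 0 with rfl | hz
  · simp [cap, radialProj]
  have hz' : 0 < ‖z‖ := norm_pos_iff.2 hz
  have h0 : 0 ≤ 1 - σ ^ 2 := by nlinarith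
  have hs : radialProj z ∈ Metric.sphere (0 : 𝔼) 1 := by
    rw [mem_sphere_zero_iff_norm, radialProj, norm_smul, norm_inv, norm_norm,
      inv_mul_cancel₀ hz'.ne']
  have h1 : radialProj z ∈ cap n a σ ↔ √((1 - σ ^ 2) * ‖z‖ ^ 2) < ⟪z, a⟫ := by
    change _ ∧ √(1 - σ ^ 2) < ⟪‖z‖⁻¹ • z, a⟫ ↔ _
    rw [and_iff_right hs, real_inner_smul_left, Real.sqrt_mul h0, Real.sqrt_sq hz'.le,
      lt_inv_mul_iff₀ hz', mul_comm]
  rw [h1, mem_doubleCone]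
  constructor
  · intro h
    have hp := (Real.sqrt_nonneg _).trans_lt h
    exact ⟨(Real.sqrt_lt' hp).1 h, hp⟩
  · rintro ⟨h, hp⟩
    exact (Real.sqrt_lt' hp).2 h

lemma nuMeasure_le_one (a : 𝔼) (σ : ℝ) (A : Set 𝔼) : nuMeasure n a σ A ≤ 1 := by
  rw [nuMeasure, Measure.smul_apply, smul_eq_mul]
  refine (mul_le_mul_right (measure_mono (Set.subset_univ A)) _).trans ?_
  rw [Measure.restrict_apply_univ]
  exact ENNReal.inv_mul_le_one _

lemma sqrt_succ_le {n : ℕ} (hn : 1 ≤ n) : √((n : ℝ) + 1) ≤ 13 / 7 * n := by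
  have : (1 : ℝ) ≤ n := by exact_mod_cast hn
  rw [Real.sqrt_le_left (by positivity)]
  nlinarith

lemma tail_constant_le {n d k : ℕ} (hn : 1 ≤ n) (hk : k ≤ d) {σ ε : ℝ} (hσ : 0 < σ)
    (hε : 0 < ε) :
    √((n : ℝ) + 1) * (σ ^ (n - 1) * (k * (2 * (7 * ε * √((n : ℝ) + 1)) / Real.pi)))
      ≤ 13 * d * n * ε / σ * (√(2 / Real.pi) * σ ^ n) := by
  have hn' : (1 : ℝ) ≤ n := by exact_mod_cast hn
  have hk' : (k : ℝ) ≤ d := by exact_mod_cast hk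
  have hπ := Real.pi_pos
  have hσn : σ ^ n = σ ^ (n - 1) * σ := by rw [← pow_succ, Nat.sub_add_cancel hn]
  have hN : √((n : ℝ) + 1) * √((n : ℝ) + 1) = n + 1 := Real.mul_self_sqrt (by positivity)
  have hc : 28 / Real.pi ≤ 13 * √(2 / Real.pi) := by
    have h1 : 28 / (13 * Real.pi) ≤ √(2 / Real.pi) := by
      rw [Real.le_sqrt' (by positivity), div_pow, div_le_div_iff₀ (by positivity) hπ]
      nlinarith [Real.pi_gt_d2]
    calc 28 / Real.pi = 13 * (28 / (13 * Real.pi)) := by field_simp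
      _ ≤ _ := by gcongr
  calc _ = σ ^ (n - 1) * ε * k * (14 / Real.pi) * (√((n : ℝ) + 1) * √((n : ℝ) + 1)) := by ring
    _ = σ ^ (n - 1) * ε * k * (14 / Real.pi) * (n + 1) := by rw [hN]
    _ ≤ σ ^ (n - 1) * ε * d * (14 / Real.pi) * (2 * n) := by gcongr; linarith
    _ = σ ^ (n - 1) * ε * d * n * (28 / Real.pi) := by ring
    _ ≤ σ ^ (n - 1) * ε * d * n * (13 * √(2 / Real.pi)) := by gcongr
    _ = _ := by rw [hσn]; field_simp

end Assembly

end GaussianSmoothing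

/-- Uniform smoothed analysis of the tail of a conic condition number
`C(z) = 1/dist(z,Σ)` (for `z ∈ Sⁿ`): for `t ≥ (2d+1)n/σ`, the event `C(z) ≥ t`
is expressed as `dist(z,Σ) ≤ 1/t` (which also covers `C(z) = ∞`), and its
`ν_{a,σ}`-probability is at most `13dn/(σt)`. -/
theorem stmt4 (n d : ℕ) (hn : 1 ≤ n) (hd : 1 ≤ d)
    (S : Set (EuclideanSpace ℝ (Fin (n + 1)))) (hSne : S.Nonempty) (hScl : IsClosed S)
    (hScone : ∀ x ∈ S, ∀ lam : ℝ, lam • x ∈ S)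
    (P : MvPolynomial (Fin (n + 1)) ℝ) (hP : P ≠ 0)
    (k : ℕ) (hk : k ≤ d) (hhom : P.IsHomogeneous k)
    (hSP : ∀ x ∈ S, MvPolynomial.eval (fun i => x i) P = 0)
    (σ : ℝ) (hσ : σ ∈ Set.Ioc (0:ℝ) 1)
    (a : EuclideanSpace ℝ (Fin (n + 1)))
    (ha : a ∈ Metric.sphere (0 : EuclideanSpace ℝ (Fin (n + 1))) 1)
    (t : ℝ) (ht : (2 * d + 1) * n / σ ≤ t) :
    nuMeasure n a σ {z | Metric.infDist z S ≤ 1 / t} ≤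
      ENNReal.ofReal (13 * d * n / (σ * t)) := by
  obtain ⟨hσ0, hσ1⟩ := hσ
  have ha' : ‖a‖ = 1 := mem_sphere_zero_iff_norm.1 ha
  have hn' : (1 : ℝ) ≤ n := by exact_mod_cast hn
  have hd' : (1 : ℝ) ≤ d := by exact_mod_cast hd
  have ht0 : 0 < t := lt_of_lt_of_le (by positivity) ht
  rcases le_or_gt 1 (13 * d * n / (σ * t)) with hbig | hsmall
  · refine (nuMeasure_le_one a σ _).trans ?_
    rw [← ENNReal.ofReal_one]
    exact ENNReal.ofReal_le_ofReal hbig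
  have hε : 0 < 1 / t := by positivity
  have hεσ : 13 * d * n * (1 / t) / σ = 13 * d * n / (σ * t) := by field_simp
  rw [← hεσ] at hsmall ⊢
  set ε := 1 / t with hεdef
  have hε1 : 7 * ε * √((n : ℝ) + 1) ≤ 1 := by
    rw [div_lt_one hσ0] at hsmall
    calc 7 * ε * √((n : ℝ) + 1) ≤ 7 * ε * (13 / 7 * n) := by gcongr; exact sqrt_succ_le hn
      _ = 13 * 1 * n * ε := by ring
      _ ≤ 13 * d * n * ε := by gcongr
      _ ≤ 1 := by linarith
  set A : Set (EuclideanSpace ℝ (Fin (n + 1))) := {z | Metric.infDist z S ≤ ε} with hA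
  have hAm : MeasurableSet A :=
    (isClosed_le (Metric.continuous_infDist_pt S) continuous_const).measurableSet
  set T : Set (EuclideanSpace ℝ (Fin (n + 1))) := {z | Metric.infDist z S ≤ ε * ‖z‖} with hTdef
  have hTm : MeasurableSet T :=
    (isClosed_le (Metric.continuous_infDist_pt S) (by fun_prop)).measurableSet
  have hTneg : ∀ z, -z ∈ T ↔ z ∈ T := fun z => by
    have h1 := infDist_smul_of_cone hScone (-1) (by norm_num) z
    rw [neg_one_smul, abs_neg, abs_one, one_mul] at h1
    simp only [hTdef, Set.mem_ofPred_eq, h1, norm_neg]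
  have hC : radialProj ⁻¹' cap n a σ = doubleCone a σ ∩ Set.univ ∩ {z | 0 < ⟪z, a⟫} := by
    ext z
    rw [Set.mem_preimage, radialProj_mem_cap hσ0 hσ1]
    simp
  have hCA : radialProj ⁻¹' (A ∩ cap n a σ) = doubleCone a σ ∩ T ∩ {z | 0 < ⟪z, a⟫} := by
    ext z
    rw [Set.mem_preimage, Set.mem_inter_iff, radialProj_mem_cap hσ0 hσ1, Set.inter_right_comm,
      Set.mem_inter_iff, Set.mem_inter_iff, and_comm]
    refine and_congr_right fun hz => ?_
    have hz0 : z ≠ 0 := by rintro rfl; simp at hz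
    have hz' : 0 < ‖z‖ := norm_pos_iff.2 hz0
    change Metric.infDist (‖z‖⁻¹ • z) S ≤ ε ↔ Metric.infDist z S ≤ ε * ‖z‖
    rw [infDist_smul_of_cone hScone _ (inv_ne_zero hz'.ne'), abs_of_pos (inv_pos.2 hz'),
      inv_mul_le_iff₀ hz', mul_comm]
  rcases nuMeasure_eq_zero_or ha' hσ0 hAm with h0 | h0
  · rw [h0]; exact zero_le
  rw [hC, hCA] at h0
  have hK := stdGaussian_doubleCone_inter (a := a) hσ0 hσ1 MeasurableSet.univ (by simp)
  have hKT := stdGaussian_doubleCone_inter (a := a) hσ0 hσ1 hTm hTneg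
  rw [Set.inter_univ] at h0 hK
  have hKν : nuMeasure n a σ A * ProbabilityTheory.stdGaussian (EuclideanSpace ℝ (Fin (n + 1))) (doubleCone a σ)
      = ProbabilityTheory.stdGaussian (EuclideanSpace ℝ (Fin (n + 1))) (doubleCone a σ ∩ T) := by
    rw [hKT, ← h0, hK]
    ring
  have hlow := measure_doubleCone_ge ha' hσ0 hσ1
  have hup := measure_doubleCone_inter_tube_le hn ha' hσ0 hσ1 hP hhom hSne hScl hScone hSP hε hε1
  have hp : 0 < √(2 / Real.pi) * σ ^ n := by have := Real.pi_pos; positivity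
  have hmain : nuMeasure n a σ A * ENNReal.ofReal (√(2 / Real.pi) * σ ^ n)
      ≤ ENNReal.ofReal (13 * d * n * ε / σ) * ENNReal.ofReal (√(2 / Real.pi) * σ ^ n) := by
    calc _ ≤ nuMeasure n a σ A * (ENNReal.ofReal √((n : ℝ) + 1)
            * ProbabilityTheory.stdGaussian (EuclideanSpace ℝ (Fin (n + 1))) (doubleCone a σ)) := by gcongr
      _ = ENNReal.ofReal √((n : ℝ) + 1)
            * ProbabilityTheory.stdGaussian (EuclideanSpace ℝ (Fin (n + 1))) (doubleCone a σ ∩ T) := by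
          rw [mul_left_comm, hKν]
      _ ≤ ENNReal.ofReal √((n : ℝ) + 1) * (ENNReal.ofReal σ ^ (n - 1)
            * ENNReal.ofReal (k * (2 * (7 * ε * √((n : ℝ) + 1)) / Real.pi))) := by gcongr
      _ = ENNReal.ofReal (√((n : ℝ) + 1)
            * (σ ^ (n - 1) * (k * (2 * (7 * ε * √((n : ℝ) + 1)) / Real.pi)))) := by
          rw [← ENNReal.ofReal_pow hσ0.le, ← ENNReal.ofReal_mul (by positivity),
            ← ENNReal.ofReal_mul (by positivity)]
      _ ≤ ENNReal.ofReal (13 * d * n * ε / σ * (√(2 / Real.pi) * σ ^ n)) :=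
          ENNReal.ofReal_le_ofReal (tail_constant_le hn hk hσ0 hε)
      _ = _ := ENNReal.ofReal_mul (by positivity)
  exact (ENNReal.mul_le_mul_iff_left (ENNReal.ofReal_pos.2 hp).ne' ENNReal.ofReal_ne_top).1 hmain
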